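/- Let f ∈ ℤ[X] belong to class 𝒫₂, i.e. f(X) = f_d X^d + f_{d-1} X^{d-1} + f_0 with d ≥ 2, f_d, f_{d-1} ≠ 0, and 0 pre-periodic under f, and set γ = -(d-1)f_{d-1}/(d f_d). Assume γ is not a pre-periodic point of f. Then there exist a constant C > 0 and Q₀ (both depending only on f) such that for all Q ≥ Q₀ one has P_f(Q) ≤ C · Q / (log Q · log log log Q). -/

import Mathlib

open Polynomial

/-- The `n`-th iterate of a polynomial: `f^(0) = X`, `f^(n) = f(f^(n-1))`. -/
noncomputable def polyIter {R : Type*} [CommSemiring R] (f : R[X]) : ℕ → R[X]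
  | 0 => X
  | n + 1 => f.comp (polyIter f n)

/-- A polynomial is dynamically irreducible if all its iterates `f^(n)`, `n ≥ 1`,
are irreducible. -/
def DynIrred {R : Type*} [CommSemiring R] (f : R[X]) : Prop :=
  ∀ n : ℕ, 1 ≤ n → Irreducible (polyIter f n)

/-- `γ ∈ ℚ` is pre-periodic for `f ∈ ℤ[X]` if its forward orbit `{f^(n)(γ) : n ≥ 1}`
is finite. -/
def IsPreperiodicPt (f : ℤ[X]) (γ : ℚ) : Prop :=
  {x : ℚ | ∃ n : ℕ, 1 ≤ n ∧ x = Polynomial.aeval γ (polyIter f n)}.Finite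

/-- `P_f(Q)`: the number of primes `p ∈ [Q, 2Q]` such that the reduction of `f` mod `p`
is dynamically irreducible over `𝔽_p`. -/
noncomputable def Pf (f : ℤ[X]) (Q : ℕ) : ℕ :=
  {p : ℕ | p.Prime ∧ Q ≤ p ∧ p ≤ 2 * Q ∧
    DynIrred (f.map (Int.castRingHom (ZMod p)))}.ncard

section Frobenius

variable {p : ℕ} [Fact p.Prime] {K : Type*} [Field K] [Algebra (ZMod p) K]

lemma aeval_pow_prime_pow (h : (ZMod p)[X]) (x : K) (i : ℕ) :
    aeval (x ^ p ^ i) h = aeval x h ^ p ^ i := by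
  have : CharP K p := charP_of_injective_algebraMap (algebraMap (ZMod p) K).injective p
  have : ExpChar K p := ExpChar.prime Fact.out
  have : (iterateFrobenius K p i).comp (algebraMap (ZMod p) K) = algebraMap (ZMod p) K :=
    RingHom.ext_zmod _ _
  have h2 := Polynomial.hom_eval₂ h (algebraMap (ZMod p) K) (iterateFrobenius K p i) x
  rw [this] at h2
  simpa [aeval_def, iterateFrobenius_def] using h2.symm

lemma pow_prime_pow_eq_self_iff {g : (ZMod p)[X]} (hg : Irreducible g) {α : K}
    (hα : aeval α g = 0) (k : ℕ) : α ^ p ^ k = α ↔ g.natDegree ∣ k := by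
  have h := hg.natDegree_dvd_iff_dvd_X_pow_card_pow_sub_X (n := k)
  rw [Nat.card_zmod] at h
  rw [h]
  constructor
  · intro h1
    have : minpoly (ZMod p) α ∣ X ^ p ^ k - X := by
      apply minpoly.dvd; simp [h1]
    refine dvd_trans ?_ this
    have hd := minpoly.dvd _ _ hα
    have hint : IsIntegral (ZMod p) α := by
      rw [← isAlgebraic_iff_isIntegral]
      exact ⟨g, hg.ne_zero, hα⟩
    exact ((minpoly.irreducible hint).associated_of_dvd hg hd).symm.dvd
  · rintro ⟨q, hq⟩
    have : aeval α ((X : (ZMod p)[X]) ^ p ^ k - X) = 0 := by rw [hq]; simp [hα]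
    simpa [sub_eq_zero] using this

lemma injective_frobenius_orbit {g : (ZMod p)[X]} (hg : Irreducible g) {α : K}
    (hα : aeval α g = 0) :
    Function.Injective fun i : Fin g.natDegree ↦ α ^ p ^ (i : ℕ) := by
  have : CharP K p := charP_of_injective_algebraMap (algebraMap (ZMod p) K).injective p
  have : ExpChar K p := ExpChar.prime Fact.out
  have key : ∀ i j : Fin g.natDegree, i ≤ j → α ^ p ^ (i : ℕ) = α ^ p ^ (j : ℕ) → i = j := by
    intro i j hij h
    obtain ⟨k, hk⟩ := Nat.exists_eq_add_of_le (Fin.le_def.mp hij)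
    have h1 : α = α ^ p ^ k := by
      apply iterateFrobenius_inj K p (i : ℕ)
      simp only [iterateFrobenius_def]
      rw [h, hk, ← pow_mul, pow_add, mul_comm]
    have h2 := (pow_prime_pow_eq_self_iff hg hα k).mp h1.symm
    have h3 : k = 0 := Nat.eq_zero_of_dvd_of_lt h2 (by have := j.2; omega)
    exact Fin.ext (by omega)
  intro i j h
  rcases le_total i j with hij | hij
  · exact key i j hij h
  · exact (key j i hij h.symm).symm

lemma map_eq_prod_frobenius_orbit {g : (ZMod p)[X]} (hg : Irreducible g) {α : K}
    (hα : aeval α g = 0) :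
    g.map (algebraMap (ZMod p) K) =
      C (algebraMap (ZMod p) K g.leadingCoeff) *
        ∏ i ∈ Finset.range g.natDegree, (X - C (α ^ p ^ i)) := by
  classical
  set G := g.map (algebraMap (ZMod p) K) with hG
  have hG0 : G ≠ 0 := (Polynomial.map_ne_zero_iff (algebraMap (ZMod p) K).injective).mpr hg.ne_zero
  have hinj := injective_frobenius_orbit hg hα
  have hdeg : G.natDegree = g.natDegree := natDegree_map _
  set s : Finset K := Finset.univ.image fun i : Fin g.natDegree ↦ α ^ p ^ (i : ℕ) with hs
  have hcard : s.card = g.natDegree := by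
    rw [hs, Finset.card_image_of_injective _ hinj]; simp
  have hle : s.val ≤ G.roots := by
    rw [Multiset.le_iff_subset s.nodup]
    intro x hx
    rw [Finset.mem_val, hs, Finset.mem_image] at hx
    obtain ⟨i, -, rfl⟩ := hx
    rw [mem_roots hG0, IsRoot, hG, eval_map_algebraMap, aeval_pow_prime_pow, hα]
    exact zero_pow (pow_ne_zero _ (Fact.out : p.Prime).ne_zero)
  have heq : s.val = G.roots := by
    apply Multiset.eq_of_le_of_card_le hle
    have := G.card_roots'
    rw [hdeg] at this
    simpa [hcard] using this
  have h := C_leadingCoeff_mul_prod_multiset_X_sub_C (p := G) (by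
    rw [← heq, hdeg]; simpa using hcard)
  rw [← h, ← heq, hG, leadingCoeff_map]
  congr 1
  change ∏ a ∈ s, (X - C a) = _
  rw [hs, Finset.prod_image (fun _ _ _ _ h ↦ hinj h), Finset.prod_range]

lemma aeval_eq_prod_frobenius_orbit {g : (ZMod p)[X]} (hg : Irreducible g) {α : K}
    (hα : aeval α g = 0) (c : K) :
    aeval c g = algebraMap (ZMod p) K g.leadingCoeff *
        ∏ i ∈ Finset.range g.natDegree, (c - α ^ p ^ i) := by
  rw [← eval_map_algebraMap, map_eq_prod_frobenius_orbit hg hα]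
  simp [eval_prod]

lemma prod_erase_sub_eq_det_vandermonde_sq {n : ℕ} (v : Fin n → K) :
    ∏ i, ∏ j ∈ Finset.univ.erase i, (v i - v j) =
      (-1) ^ (n * (n - 1) / 2) * (Matrix.vandermonde v).det ^ 2 := by
  have hsplit : ∀ i : Fin n, ∏ j ∈ Finset.univ.erase i, (v i - v j) =
      (∏ j ∈ Finset.Ioi i, (v i - v j)) * ∏ j ∈ Finset.Iio i, (v i - v j) := by
    intro i
    rw [← Finset.prod_union]
    · congr 1
      ext j
      simp only [Finset.mem_erase, Finset.mem_univ, and_true, Finset.mem_union, Finset.mem_Ioi,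
        Finset.mem_Iio]
      constructor
      · intro h; rcases lt_or_gt_of_ne h with h | h <;> simp [h]
      · rintro (h | h); exacts [h.ne', h.ne]
    · rw [Finset.disjoint_left]
      intro j h1 h2
      exact lt_asymm (Finset.mem_Ioi.mp h1) (Finset.mem_Iio.mp h2)
  rw [Finset.prod_congr rfl fun i _ ↦ hsplit i, Finset.prod_mul_distrib, sq, ← mul_assoc]
  congr 1
  · have : ∀ i : Fin n, ∏ j ∈ Finset.Ioi i, (v i - v j) =
        (-1) ^ (n - 1 - (i : ℕ)) * ∏ j ∈ Finset.Ioi i, (v j - v i) := by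
      intro i
      rw [← Fin.card_Ioi, ← Finset.prod_const, ← Finset.prod_mul_distrib]
      exact Finset.prod_congr rfl fun j _ ↦ by ring
    rw [Finset.prod_congr rfl fun i _ ↦ this i, Finset.prod_mul_distrib, Matrix.det_vandermonde,
      Finset.prod_pow_eq_pow_sum]
    congr 2
    rw [← Finset.sum_range_id, Fin.sum_univ_eq_sum_range (fun i ↦ n - 1 - i)]
    exact Finset.sum_range_reflect (fun i ↦ i) n
  · rw [Matrix.det_vandermonde]
    exact Finset.prod_comm' (by simp)

lemma exists_prod_derivative_eq {g : (ZMod p)[X]} (hg : Irreducible g) {α : K}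
    (hα : aeval α g = 0) :
    ∃ δ : K, δ ≠ 0 ∧ δ ^ p = (-1) ^ (g.natDegree - 1) * δ ∧
      ∏ i ∈ Finset.range g.natDegree, aeval (α ^ p ^ i) (derivative g) =
        algebraMap (ZMod p) K g.leadingCoeff ^ g.natDegree *
          ((-1) ^ (g.natDegree * (g.natDegree - 1) / 2) * δ ^ 2) := by
  classical
  have : CharP K p := charP_of_injective_algebraMap (algebraMap (ZMod p) K).injective p
  have : ExpChar K p := ExpChar.prime Fact.out
  set v : Fin g.natDegree → K := fun i ↦ α ^ p ^ (i : ℕ) with hv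
  have hinj : Function.Injective v := injective_frobenius_orbit hg hα
  refine ⟨(Matrix.vandermonde v).det, Matrix.det_vandermonde_ne_zero_iff.mpr hinj, ?_, ?_⟩
  · have h1 := RingHom.map_det (frobenius K p) (Matrix.vandermonde v)
    rw [frobenius_def] at h1
    rw [h1]
    have h2 : (frobenius K p).mapMatrix (Matrix.vandermonde v) =
        (Matrix.vandermonde v).submatrix (finRotate g.natDegree) id := by
      ext i j
      simp only [RingHom.mapMatrix_apply, Matrix.map_apply, Matrix.vandermonde_apply,
        Matrix.submatrix_apply, id, frobenius_def, hv]
      have : (α ^ p ^ (i : ℕ)) ^ p = α ^ p ^ ((finRotate g.natDegree i : Fin _) : ℕ) := by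
        obtain ⟨m, hm⟩ : ∃ m, g.natDegree = m + 1 := ⟨_, (Nat.succ_pred hg.natDegree_pos.ne').symm⟩
        have hper := (pow_prime_pow_eq_self_iff hg hα g.natDegree).mpr dvd_rfl
        generalize hN : g.natDegree = N at *
        subst hm
        rw [← pow_mul, ← pow_succ]
        by_cases hi : i = Fin.last m
        · rw [hi, finRotate_last]
          simpa using hper
        · rw [coe_finRotate_of_ne_last hi]
      rw [← this]; ring
    rw [h2, Matrix.det_permute, sign_finRotate]
    simp
  · rw [← prod_erase_sub_eq_det_vandermonde_sq]
    have hroot : ∀ i : Fin g.natDegree, aeval (v i) (derivative g) =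
        algebraMap (ZMod p) K g.leadingCoeff * ∏ j ∈ Finset.univ.erase i, (v i - v j) := by
      intro i
      rw [← eval_map_algebraMap, ← derivative_map, map_eq_prod_frobenius_orbit hg hα,
        derivative_C_mul, eval_C_mul, Finset.prod_range (fun i ↦ X - C (α ^ p ^ i)),
        derivative_prod_finset, eval_finsetSum, Finset.sum_eq_single i]
      · simp only [derivative_X_sub_C, mul_one, eval_prod, eval_sub, eval_X, eval_C, hv]
      · intro j _ hj
        rw [eval_mul, eval_prod, Finset.prod_eq_zero (i := i), zero_mul]
        · simpa using hj.symm
        · simp [hv]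
      · simp
    rw [Finset.prod_range (fun i ↦ aeval (α ^ p ^ i) (derivative g)),
      Finset.prod_congr rfl fun i _ ↦ hroot i, Finset.prod_mul_distrib]
    simp

end Frobenius

section Iterates

lemma polyIter_comp_comm {R : Type*} [CommSemiring R] (f : R[X]) (n : ℕ) :
    polyIter f (n + 1) = (polyIter f n).comp f := by
  induction n with
  | zero => simp [polyIter]
  | succ n ih => rw [polyIter, ih, ← comp_assoc]; exact congrArg (·.comp f) ih

lemma aeval_polyIter {R A : Type*} [CommSemiring R] [CommSemiring A] [Algebra R A] (f : R[X])
    (x : A) (n : ℕ) : aeval x (polyIter f n) = (fun t ↦ aeval t f)^[n] x := by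
  induction n with
  | zero => simp [polyIter]
  | succ n ih => rw [polyIter, aeval_comp, ih, Function.iterate_succ_apply']

lemma eval_polyIter {R : Type*} [CommSemiring R] (f : R[X]) (x : R) (n : ℕ) :
    eval x (polyIter f n) = (fun t ↦ eval t f)^[n] x := by
  simpa using aeval_polyIter f x n

lemma polyIter_map {R S : Type*} [CommSemiring R] [CommSemiring S] (φ : R →+* S) (f : R[X])
    (n : ℕ) : (polyIter f n).map φ = polyIter (f.map φ) n := by
  induction n with
  | zero => simp [polyIter]
  | succ n ih => rw [polyIter, polyIter, Polynomial.map_comp, ih]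

lemma natDegree_polyIter {R : Type*} [CommRing R] [IsDomain R] (f : R[X]) (n : ℕ) :
    (polyIter f n).natDegree = f.natDegree ^ n := by
  induction n with
  | zero => simp [polyIter]
  | succ n ih => rw [polyIter, natDegree_comp, ih, pow_succ, mul_comm]

lemma leadingCoeff_polyIter_succ {R : Type*} [CommRing R] [IsDomain R] (f : R[X])
    (hf : f.natDegree ≠ 0) (n : ℕ) :
    (polyIter f (n + 1)).leadingCoeff =
      f.leadingCoeff * (polyIter f n).leadingCoeff ^ f.natDegree := by
  rw [polyIter, leadingCoeff_comp]
  rw [natDegree_polyIter]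
  exact pow_ne_zero _ hf

lemma leadingCoeff_polyIter {R : Type*} [CommRing R] [IsDomain R] (f : R[X])
    (hf : f.natDegree ≠ 0) (n : ℕ) :
    (polyIter f n).leadingCoeff = f.leadingCoeff ^ ∑ l ∈ Finset.range n, f.natDegree ^ l := by
  induction n with
  | zero => simp [polyIter]
  | succ n ih =>
    rw [leadingCoeff_polyIter_succ f hf, ih, ← pow_mul, ← pow_succ', Finset.sum_range_succ',
      Finset.sum_mul]
    simp [pow_succ]

end Iterates

section CriticalOrbit

variable {p : ℕ} [Fact p.Prime] {K : Type*} [Field K] [Algebra (ZMod p) K]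

/-- The product of the values of `h` at the roots of `g` in `K`. -/
noncomputable def rootProd (K : Type*) [Field K] [Algebra (ZMod p) K] (g h : (ZMod p)[X]) : K :=
  ((g.aroots K).map fun r ↦ aeval r h).prod

lemma rootProd_mul (g h₁ h₂ : (ZMod p)[X]) :
    rootProd K g (h₁ * h₂) = rootProd K g h₁ * rootProd K g h₂ := by
  simp [rootProd, Multiset.prod_map_mul]

lemma rootProd_pow (g h : (ZMod p)[X]) (k : ℕ) :
    rootProd K g (h ^ k) = rootProd K g h ^ k := by
  simp [rootProd, Multiset.prod_map_pow]

lemma rootProd_eq_prod {g : (ZMod p)[X]} (hg : Irreducible g) {α : K}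
    (hα : aeval α g = 0) (h : (ZMod p)[X]) :
    rootProd K g h = ∏ i ∈ Finset.range g.natDegree, aeval (α ^ p ^ i) h := by
  have hlc : algebraMap (ZMod p) K g.leadingCoeff ≠ 0 := by
    simpa using leadingCoeff_ne_zero.mpr hg.ne_zero
  rw [rootProd, aroots_def, map_eq_prod_frobenius_orbit hg hα, roots_C_mul _ hlc,
    roots_prod _ _ (Finset.prod_ne_zero_iff.mpr fun _ _ ↦ X_sub_C_ne_zero _)]
  simp only [roots_X_sub_C, Multiset.bind_singleton]
  simp [Finset.prod]

lemma prod_range_mul_of_periodic {M : Type*} [CommMonoid M] (u : ℕ → M) (N k : ℕ)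
    (hu : ∀ i, u (i + N) = u i) :
    ∏ i ∈ Finset.range (N * k), u i = (∏ i ∈ Finset.range N, u i) ^ k := by
  have hu' : ∀ k i, u (N * k + i) = u i := by
    intro k
    induction k with
    | zero => simp
    | succ k ih => intro i; rw [← ih i, ← hu (N * k + i)]; congr 1; ring
  induction k with
  | zero => simp
  | succ k ih =>
    rw [Nat.mul_succ, Finset.prod_range_add, ih, pow_succ]
    simp [hu']

lemma exists_aeval_eq_zero_of_irreducible [IsAlgClosed K] {g : (ZMod p)[X]}
    (hg : Irreducible g) : ∃ α : K, aeval α g = 0 :=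
  IsAlgClosed.exists_aeval_eq_zero K g (degree_pos_of_irreducible hg).ne'

lemma rootProd_polyIter_comp [IsAlgClosed K] {g : (ZMod p)[X]} (hg : DynIrred g) {n : ℕ}
    (hn : 1 ≤ n) (h : (ZMod p)[X]) :
    rootProd K (polyIter g (n + 1)) (h.comp g) =
      rootProd K (polyIter g n) h ^ g.natDegree := by
  obtain ⟨α, hα⟩ := exists_aeval_eq_zero_of_irreducible (K := K) (hg (n + 1) (by omega))
  have hβ : aeval (aeval α g) (polyIter g n) = 0 := by
    rw [← aeval_comp, ← polyIter_comp_comm, hα]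
  rw [rootProd_eq_prod (hg _ (by omega)) hα, rootProd_eq_prod (hg _ hn) hβ,
    natDegree_polyIter, natDegree_polyIter, pow_succ,
    ← prod_range_mul_of_periodic]
  · refine Finset.prod_congr rfl fun i _ ↦ ?_
    rw [aeval_comp, aeval_pow_prime_pow]
  · intro i
    have := (pow_prime_pow_eq_self_iff (hg _ hn) hβ (g.natDegree ^ n)).mpr
      (by rw [natDegree_polyIter])
    rw [pow_add, mul_comm, pow_mul, this]

lemma rootProd_X_sub_C [IsAlgClosed K] {g : (ZMod p)[X]} (hg : Irreducible g) (c : ZMod p) :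
    algebraMap (ZMod p) K g.leadingCoeff * rootProd K g (X - C c) =
      (-1) ^ g.natDegree * algebraMap (ZMod p) K (eval c g) := by
  obtain ⟨α, hα⟩ := exists_aeval_eq_zero_of_irreducible (K := K) hg
  have h := aeval_eq_prod_frobenius_orbit hg hα (algebraMap (ZMod p) K c)
  rw [aeval_algebraMap_apply, coe_aeval_eq_eval] at h
  rw [h, rootProd_eq_prod hg hα, mul_left_comm]
  congr 1
  have : (-1 : K) ^ g.natDegree = ∏ _i ∈ Finset.range g.natDegree, -1 := by simp
  rw [this, ← Finset.prod_mul_distrib]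
  exact Finset.prod_congr rfl fun i _ ↦ by simp

lemma rootProd_C [IsAlgClosed K] {g : (ZMod p)[X]} (hg : Irreducible g) (c : ZMod p) :
    rootProd K g (C c) = algebraMap (ZMod p) K c ^ g.natDegree := by
  obtain ⟨α, hα⟩ := exists_aeval_eq_zero_of_irreducible (K := K) hg
  rw [rootProd_eq_prod hg hα]
  simp

lemma rootProd_derivative_pow [IsAlgClosed K] {g : (ZMod p)[X]} (hg : Irreducible g)
    (hp : p ≠ 2) :
    rootProd K g (derivative g) ^ (p / 2) =
      (algebraMap (ZMod p) K g.leadingCoeff ^ (p / 2)) ^ g.natDegree *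
        ((-1) ^ (p / 2)) ^ (g.natDegree * (g.natDegree - 1) / 2) * (-1) ^ (g.natDegree - 1) := by
  obtain ⟨α, hα⟩ := exists_aeval_eq_zero_of_irreducible (K := K) hg
  obtain ⟨δ, hδ0, hδp, hδ⟩ := exists_prod_derivative_eq hg hα
  have hodd : 2 * (p / 2) + 1 = p := by
    have := (Fact.out : p.Prime).eq_two_or_odd
    omega
  have h1 : δ ^ (2 * (p / 2)) = (-1) ^ (g.natDegree - 1) := by
    apply mul_right_cancel₀ hδ0
    rw [← pow_succ, hodd, hδp]
  rw [rootProd_eq_prod hg hα, hδ, mul_pow, mul_pow, ← pow_mul δ, h1]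
  ring

lemma pow_eq_pow_of_mod_two_eq {M : Type*} [Monoid M] {x : M} (hx : x ^ 2 = 1) {i j : ℕ}
    (hij : i % 2 = j % 2) : x ^ i = x ^ j := by
  rw [← Nat.div_add_mod i 2, ← Nat.div_add_mod j 2, pow_add, pow_add, pow_mul, pow_mul, hx, hij]
  simp

lemma choose_two_mod_two {m m' : ℕ} (h : m % 4 = m' % 4) :
    (m * (m - 1) / 2) % 2 = (m' * (m' - 1) / 2) % 2 := by
  have key : ∀ q r : ℕ, r < 4 → ((4 * q + r) * (4 * q + r - 1) / 2) % 2 = (r / 2) % 2 := by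
    intro q r hr
    rw [← Nat.choose_two_right]
    induction q with
    | zero => interval_cases r <;> rfl
    | succ q ih =>
      rw [← ih]
      have : 4 * (q + 1) + r = (4 * q + r) + 1 + 1 + 1 + 1 := by ring
      rw [this]
      simp only [Nat.choose_succ_succ' _ 1, Nat.choose_one_right]
      have h2 : (4 * q + r).choose (1 + 1) = (4 * q + r).choose 2 := rfl
      omega
  rw [← Nat.div_add_mod m 4, ← Nat.div_add_mod m' 4, h, key _ _ (Nat.mod_lt _ (by omega)),
    key _ _ (Nat.mod_lt _ (by omega))]

lemma pow_add_two_mod_four (d : ℕ) {n : ℕ} (hn : 2 ≤ n) : d ^ (n + 2) % 4 = d ^ n % 4 := by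
  obtain ⟨k, rfl⟩ := Nat.exists_eq_add_of_le hn
  have : d ^ (2 + k + 2) % 4 = (d ^ 4 % 4 * (d ^ k % 4)) % 4 := by
    rw [← Nat.mul_mod]; ring_nf
  rw [this, pow_add, Nat.mul_mod (d ^ 2)]
  congr 2
  rw [Nat.pow_mod, Nat.pow_mod d 2]
  have : d % 4 < 4 := Nat.mod_lt _ (by omega)
  interval_cases d % 4 <;> rfl

lemma pow_add_two_mod_two (d : ℕ) {n : ℕ} (hn : 1 ≤ n) : d ^ (n + 2) % 2 = d ^ n % 2 := by
  rw [Nat.pow_mod, Nat.pow_mod d n]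
  rcases Nat.mod_two_eq_zero_or_one d with h | h <;> rw [h]
  · rw [zero_pow (by omega), zero_pow (by omega)]
  · simp

variable {g : (ZMod p)[X]} {e c₀ : ZMod p}

lemma two_mul_half_add_one (hp : p ≠ 2) : 2 * (p / 2) + 1 = p := by
  have := (Fact.out : p.Prime).eq_two_or_odd
  omega

lemma pow_half_sq (hp : p ≠ 2) {x : ZMod p} (hx : x ≠ 0) : (x ^ (p / 2)) ^ 2 = 1 := by
  have := two_mul_half_add_one hp
  rw [← pow_mul, mul_comm, show 2 * (p / 2) = p - 1 by omega]
  exact ZMod.pow_card_sub_one_eq_one hx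

lemma DynIrred.eval_ne_zero (hg : DynIrred g) (hd : 2 ≤ g.natDegree) {n : ℕ} (hn : 1 ≤ n)
    (c : ZMod p) : eval c (polyIter g n) ≠ 0 := by
  intro h
  have h1 : _ = 1 :=
    natDegree_eq_of_degree_eq_some (degree_eq_one_of_irreducible_of_root (hg n hn) h)
  rw [natDegree_polyIter] at h1
  have h2 : g.natDegree ^ 1 ≤ g.natDegree ^ n := Nat.pow_le_pow_right (by omega) hn
  rw [pow_one] at h2
  omega

lemma rootProd_derivative_self_pow_add_two (hg : DynIrred g) (hp : p ≠ 2)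
    (hd : 2 ≤ g.natDegree) {n : ℕ} (hn : 2 ≤ n) :
    rootProd (AlgebraicClosure (ZMod p)) (polyIter g (n + 2)) (derivative (polyIter g (n + 2)))
        ^ (p / 2) =
      rootProd (AlgebraicClosure (ZMod p)) (polyIter g n) (derivative (polyIter g n))
        ^ (p / 2) := by
  have hg0 : g.leadingCoeff ≠ 0 := by
    rw [Ne, leadingCoeff_eq_zero]; rintro rfl; simp at hd
  have hlc : (polyIter g n).leadingCoeff ≠ 0 := leadingCoeff_ne_zero.mpr (hg n (by omega)).ne_zero
  have hm1 : ((-1 : AlgebraicClosure (ZMod p)) ^ (p / 2)) ^ 2 = 1 := by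
    rw [← pow_mul, mul_comm, pow_mul]; simp
  rw [rootProd_derivative_pow (hg _ (by omega)) hp, rootProd_derivative_pow (hg _ (by omega)) hp,
    natDegree_polyIter, natDegree_polyIter]
  congr 1
  · congr 1
    · simp only [← map_pow]
      congr 1
      rw [leadingCoeff_polyIter_succ g (by omega), leadingCoeff_polyIter_succ g (by omega)]
      have h1 := pow_half_sq hp hg0
      have h2 := pow_half_sq hp hlc
      calc _ = ((g.leadingCoeff ^ (p / 2)) ^ 2) ^ ((1 + g.natDegree) * g.natDegree / 2 *
              g.natDegree ^ (n + 1)) *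
            ((polyIter g n).leadingCoeff ^ (p / 2)) ^ (g.natDegree ^ (n + 2 + 2)) := by
            have h3 : 2 * ((1 + g.natDegree) * g.natDegree / 2) =
                (1 + g.natDegree) * g.natDegree := by
              apply Nat.mul_div_cancel'
              rw [mul_comm, add_comm]; exact (Nat.even_mul_succ_self _).two_dvd
            rw [← pow_mul _ 2, ← mul_assoc 2, h3]
            ring
        _ = _ := by
            rw [h1, one_pow, one_mul]
            apply pow_eq_pow_of_mod_two_eq h2
            rw [pow_add_two_mod_two _ (by omega), pow_add_two_mod_two _ (by omega)]
    · apply pow_eq_pow_of_mod_two_eq hm1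
      exact choose_two_mod_two (pow_add_two_mod_four _ hn)
  · apply pow_eq_pow_of_mod_two_eq (by simp)
    have h1 := pow_add_two_mod_two g.natDegree (n := n) (by omega)
    have h2 : 0 < g.natDegree ^ (n + 2) := pow_pos (by omega) _
    have h3 : 0 < g.natDegree ^ n := pow_pos (by omega) _
    omega

lemma rootProd_derivative_polyIter_succ [IsAlgClosed K] (hg : DynIrred g) {n : ℕ} (hn : 1 ≤ n) :
    rootProd K (polyIter g (n + 1)) (derivative (polyIter g (n + 1))) =
      rootProd K (polyIter g n) (derivative (polyIter g n)) ^ g.natDegree *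
        rootProd K (polyIter g (n + 1)) (derivative g) := by
  conv_lhs => rw [polyIter_comp_comm g n, derivative_comp, ← polyIter_comp_comm g n]
  rw [mul_comm, rootProd_mul, rootProd_polyIter_comp hg hn]

lemma rootProd_derivative_ne_zero [IsAlgClosed K] (hg : DynIrred g) (hp : p ≠ 2) {n : ℕ}
    (hn : 1 ≤ n) : rootProd K (polyIter g n) (derivative (polyIter g n)) ≠ 0 := by
  have h := rootProd_derivative_pow (K := K) (hg n hn) hp
  intro h0
  have := two_mul_half_add_one hp
  have := (Fact.out : p.Prime).two_le
  rw [h0, zero_pow (by omega)] at h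
  have hlc : (polyIter g n).leadingCoeff ≠ 0 := leadingCoeff_ne_zero.mpr (hg n hn).ne_zero
  have : algebraMap (ZMod p) K (polyIter g n).leadingCoeff ≠ 0 := by simpa using hlc
  revert h
  simp [this]

lemma rootProd_derivative_pow_add_two (hg : DynIrred g) (hp : p ≠ 2)
    (hd : 2 ≤ g.natDegree) {n : ℕ} (hn : 3 ≤ n) :
    rootProd (AlgebraicClosure (ZMod p)) (polyIter g (n + 2)) (derivative g) ^ (p / 2) =
      rootProd (AlgebraicClosure (ZMod p)) (polyIter g n) (derivative g) ^ (p / 2) := by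
  obtain ⟨n, rfl⟩ : ∃ m, n = m + 1 := ⟨n - 1, by omega⟩
  have h1 := congrArg (· ^ (p / 2)) (rootProd_derivative_polyIter_succ
    (K := AlgebraicClosure (ZMod p)) hg (n := n) (by omega))
  have h2 := congrArg (· ^ (p / 2)) (rootProd_derivative_polyIter_succ
    (K := AlgebraicClosure (ZMod p)) hg (n := n + 2) (by omega))
  have h3 := rootProd_derivative_self_pow_add_two hg hp hd (n := n) (by omega)
  have h4 := rootProd_derivative_self_pow_add_two hg hp hd (n := n + 1) (by omega)
  have h0 := rootProd_derivative_ne_zero (K := AlgebraicClosure (ZMod p)) hg hp (n := n) (by omega)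
  simp only [mul_pow] at h1 h2
  rw [show n + 2 + 1 = n + 1 + 2 by ring, h4, h1, pow_right_comm, pow_right_comm _ g.natDegree,
    h3] at h2
  exact (mul_left_cancel₀ (pow_ne_zero _ (pow_ne_zero _ h0)) h2).symm

lemma pow_half_eval_polyIter_add_two (hg : DynIrred g) (hp : p ≠ 2) (hd : 2 ≤ g.natDegree)
    (he : e ≠ 0) (hder : derivative g = C e * X ^ (g.natDegree - 2) * (X - C c₀))
    {n : ℕ} (hn : 3 ≤ n) :
    (eval 0 (polyIter g (n + 2)) ^ (p / 2)) ^ (g.natDegree - 2) *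
        eval c₀ (polyIter g (n + 2)) ^ (p / 2) =
      (eval 0 (polyIter g n) ^ (p / 2)) ^ (g.natDegree - 2) *
        eval c₀ (polyIter g n) ^ (p / 2) := by
  set K := AlgebraicClosure (ZMod p)
  have hg0 : g.leadingCoeff ≠ 0 := by
    rw [Ne, leadingCoeff_eq_zero]; rintro rfl; simp at hd
  have hE : ∀ m, 1 ≤ m →
      (algebraMap (ZMod p) K (polyIter g m).leadingCoeff ^ (p / 2)) ^ (g.natDegree - 1) *
        rootProd K (polyIter g m) (derivative g) ^ (p / 2) =
      algebraMap (ZMod p) K ((e ^ (p / 2)) ^ (g.natDegree ^ m) *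
        (((-1) ^ (p / 2)) ^ (g.natDegree ^ m)) ^ (g.natDegree - 1) *
        ((eval 0 (polyIter g m) ^ (p / 2)) ^ (g.natDegree - 2) *
        eval c₀ (polyIter g m) ^ (p / 2))) := by
    intro m hm
    have h0 := rootProd_X_sub_C (K := K) (hg m hm) 0
    have hc := rootProd_X_sub_C (K := K) (hg m hm) c₀
    rw [C_0, sub_zero] at h0
    obtain ⟨k, hk⟩ : ∃ k, g.natDegree = k + 2 := ⟨g.natDegree - 2, by omega⟩
    rw [hder, rootProd_mul, rootProd_mul, rootProd_pow, rootProd_C (hg m hm)]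
    rw [show g.natDegree - 1 = (g.natDegree - 2) + 1 by omega]
    generalize hL : algebraMap (ZMod p) K (polyIter g m).leadingCoeff = L at *
    generalize hA : rootProd K (polyIter g m) X = A at *
    generalize hB : rootProd K (polyIter g m) (X - C c₀) = B at *
    rw [natDegree_polyIter] at *
    calc _ = (algebraMap (ZMod p) K e ^ (p / 2)) ^ (g.natDegree ^ m) *
          ((L * A) ^ (p / 2)) ^ (g.natDegree - 2) * (L * B) ^ (p / 2) := by ring
      _ = _ := by
        rw [h0, hc]
        simp only [map_mul, map_pow, map_neg, map_one]
        ring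
  have hL : ∀ m, 1 ≤ m → ((polyIter g m).leadingCoeff ^ (p / 2)) ^ (g.natDegree - 1) =
      (g.leadingCoeff ^ (p / 2)) ^ (g.natDegree - 1) := by
    intro m hm
    obtain ⟨m, rfl⟩ : ∃ k, m = k + 1 := ⟨m - 1, by omega⟩
    have hlc : (polyIter g m).leadingCoeff ≠ 0 := by
      rw [leadingCoeff_polyIter g (by omega)]; exact pow_ne_zero _ hg0
    rw [leadingCoeff_polyIter_succ g (by omega), mul_pow, mul_pow]
    have h2 : 2 * (g.natDegree * (g.natDegree - 1) / 2) = g.natDegree * (g.natDegree - 1) :=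
      Nat.mul_div_cancel' (Nat.even_mul_pred_self _).two_dvd
    have : (((polyIter g m).leadingCoeff ^ g.natDegree) ^ (p / 2)) ^ (g.natDegree - 1) = 1 := by
      calc _ = (((polyIter g m).leadingCoeff ^ (p / 2)) ^ 2) ^
            (g.natDegree * (g.natDegree - 1) / 2) := by rw [← pow_mul _ 2, h2]; ring
        _ = 1 := by rw [pow_half_sq hp hlc, one_pow]
    rw [this, mul_one]
  have h1 := hE n (by omega)
  have h2 := hE (n + 2) (by omega)
  rw [rootProd_derivative_pow_add_two hg hp hd hn, ← map_pow, ← map_pow, hL _ (by omega)] at h2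
  rw [← map_pow, ← map_pow, hL _ (by omega), h2] at h1
  have h3 := (algebraMap (ZMod p) K).injective h1
  have hpar := pow_add_two_mod_two g.natDegree (n := n) (by omega)
  rw [pow_eq_pow_of_mod_two_eq (pow_half_sq hp he) hpar,
    pow_eq_pow_of_mod_two_eq (pow_half_sq hp (x := -1) (by simp)) hpar] at h3
  refine mul_left_cancel₀ ?_ h3
  simp [he]

/-- For a dynamically irreducible polynomial with critical points `0` and `c₀` only, the quadratic
character of `g^(n)(c₀)` depends only on the parity of `n` and on `g^(n)(0)`. -/
lemma DynIrred.pow_half_eval_polyIter_eq (hg : DynIrred g) (hp : p ≠ 2) (hd : 2 ≤ g.natDegree)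
    (he : e ≠ 0) (hder : derivative g = C e * X ^ (g.natDegree - 2) * (X - C c₀))
    {n : ℕ} (hn : 3 ≤ n) (k : ℕ)
    (h0 : eval 0 (polyIter g (n + 2 * k)) = eval 0 (polyIter g n)) :
    eval c₀ (polyIter g (n + 2 * k)) ^ (p / 2) = eval c₀ (polyIter g n) ^ (p / 2) := by
  have key : ∀ k, (eval 0 (polyIter g (n + 2 * k)) ^ (p / 2)) ^ (g.natDegree - 2) *
        eval c₀ (polyIter g (n + 2 * k)) ^ (p / 2) =
      (eval 0 (polyIter g n) ^ (p / 2)) ^ (g.natDegree - 2) *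
        eval c₀ (polyIter g n) ^ (p / 2) := by
    intro k
    induction k with
    | zero => rfl
    | succ k ih =>
      rw [← ih]
      exact pow_half_eval_polyIter_add_two hg hp hd he hder (n := n + 2 * k) (by omega)
  have h := key k
  rw [h0] at h
  have hne : eval 0 (polyIter g n) ≠ 0 := hg.eval_ne_zero hd (by omega) 0
  exact mul_left_cancel₀ (pow_ne_zero _ (pow_ne_zero _ hne)) h

end CriticalOrbit

section SelbergSieve

open Finset ArithmeticFunction

/-- The normalising sum in Selberg's sieve of level `D`. -/
noncomputable def selbergMass (D : ℕ) : ℝ :=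
  ∑ m ∈ Icc 1 D, ((moebius m : ℤ) : ℝ) ^ 2 / Nat.totient m

/-- The diagonalised coefficients of Selberg's sieve of level `D`. -/
noncomputable def selbergDiag (D m : ℕ) : ℝ :=
  ((moebius m : ℤ) : ℝ) / (Nat.totient m * selbergMass D)

/-- Selberg's sieve coefficients of level `D`. -/
noncomputable def selbergCoeff (D d : ℕ) : ℝ :=
  d * ∑ m ∈ Icc 1 D with d ∣ m, ((moebius (m / d) : ℤ) : ℝ) * selbergDiag D m

/-- The Selberg upper bound majorant of level `D`. -/
noncomputable def selbergMajorant (D k : ℕ) : ℝ :=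
  (∑ d ∈ Icc 1 D with d ∣ k, selbergCoeff D d) ^ 2

lemma selbergMass_pos {D : ℕ} (hD : 1 ≤ D) : 0 < selbergMass D := by
  refine sum_pos' (fun m _ ↦ by positivity) ⟨1, by simpa using hD, by simp⟩

lemma moebius_sq_eq_abs (m : ℕ) : ((moebius m : ℤ) : ℝ) ^ 2 = |((moebius m : ℤ) : ℝ)| := by
  rcases moebius_eq_or m with h | h | h <;> simp [h]

lemma abs_moebius_cast_le_one (m : ℕ) : |((moebius m : ℤ) : ℝ)| ≤ 1 := by
  rcases moebius_eq_or m with h | h | h <;> simp [h]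

lemma selbergCoeff_one {D : ℕ} (hD : 1 ≤ D) : selbergCoeff D 1 = 1 := by
  have hS := selbergMass_pos hD
  have : ∀ m, ((moebius m : ℤ) : ℝ) * selbergDiag D m =
      ((moebius m : ℤ) : ℝ) ^ 2 / Nat.totient m / selbergMass D := by
    intro m; rw [selbergDiag]; ring
  simp only [selbergCoeff, one_dvd, filter_true, Nat.div_one, this, ← sum_div]
  rw [← selbergMass, div_self hS.ne']; simp

lemma abs_selbergCoeff_le {D : ℕ} (hD : 1 ≤ D) (d : ℕ) : |selbergCoeff D d| ≤ d := by
  have hS := selbergMass_pos hD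
  rw [selbergCoeff, abs_mul, Nat.abs_cast]
  refine mul_le_of_le_one_right (by positivity) ?_
  calc _ ≤ ∑ m ∈ Icc 1 D with d ∣ m, |((moebius (m / d) : ℤ) : ℝ) * selbergDiag D m| :=
        abs_sum_le_sum_abs _ _
    _ ≤ ∑ m ∈ Icc 1 D, |((moebius (m / d) : ℤ) : ℝ) * selbergDiag D m| :=
        sum_le_sum_of_subset_of_nonneg (filter_subset _ _) fun _ _ _ ↦ abs_nonneg _
    _ ≤ ∑ m ∈ Icc 1 D, ((moebius m : ℤ) : ℝ) ^ 2 / Nat.totient m / selbergMass D := by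
        refine sum_le_sum fun m _ ↦ ?_
        rw [abs_mul, selbergDiag, abs_div, moebius_sq_eq_abs, abs_mul, Nat.abs_cast,
          abs_of_pos hS, div_div]
        exact mul_le_of_le_one_left (by positivity) (abs_moebius_cast_le_one _)
    _ = 1 := by rw [← sum_div, ← selbergMass, div_self hS.ne']

lemma sum_moebius_div_of_dvd {m n : ℕ} (hn : n ≠ 0) (hmn : m ∣ n) :
    ∑ d ∈ n.divisors with m ∣ d, ((moebius (n / d) : ℤ) : ℝ) = if m = n then 1 else 0 := by
  obtain ⟨k, rfl⟩ := hmn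
  obtain ⟨hm, hk⟩ := mul_ne_zero_iff.mp hn
  have h1 : ∑ d ∈ (m * k).divisors with m ∣ d, ((moebius (m * k / d) : ℤ) : ℝ) =
      ∑ c ∈ k.divisors, ((moebius (k / c) : ℤ) : ℝ) := by
    symm
    refine sum_bij' (fun c _ ↦ m * c) (fun d _ ↦ d / m) ?_ ?_ ?_ ?_ ?_
    · intro c hc
      simp only [Nat.mem_divisors, mem_filter] at hc ⊢
      exact ⟨⟨mul_dvd_mul_left m hc.1, hn⟩, dvd_mul_right _ _⟩
    · intro d hd
      simp only [Nat.mem_divisors, mem_filter] at hd ⊢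
      obtain ⟨⟨h1, -⟩, e, rfl⟩ := hd
      rw [Nat.mul_div_cancel_left _ (Nat.pos_of_ne_zero hm)]
      exact ⟨Nat.dvd_of_mul_dvd_mul_left (Nat.pos_of_ne_zero hm) h1, hk⟩
    · intro c _; exact Nat.mul_div_cancel_left _ (Nat.pos_of_ne_zero hm)
    · intro d hd; exact Nat.mul_div_cancel' (mem_filter.mp hd).2
    · intro c _; rw [Nat.mul_div_mul_left _ _ (Nat.pos_of_ne_zero hm)]
  rw [h1, Nat.sum_div_divisors k (fun c ↦ ((moebius c : ℤ) : ℝ)), ← Int.cast_sum,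
    ← coe_mul_zeta_apply, moebius_mul_coe_zeta, one_apply]
  simp [hm]

lemma sum_selbergCoeff_div {D m : ℕ} (hm : m ∈ Icc 1 D) :
    ∑ d ∈ Icc 1 D with m ∣ d, selbergCoeff D d / d = selbergDiag D m := by
  have h1 : ∀ d ∈ (Icc 1 D).filter (m ∣ ·), selbergCoeff D d / d =
      ∑ n ∈ Icc 1 D with d ∣ n, ((moebius (n / d) : ℤ) : ℝ) * selbergDiag D n := by
    intro d hd
    have : (d : ℝ) ≠ 0 := by
      have := (mem_Icc.mp (mem_filter.mp hd).1).1
      exact_mod_cast (by omega : d ≠ 0)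
    rw [selbergCoeff, mul_div_cancel_left₀ _ this]
  rw [sum_congr rfl h1]
  have h2 : ∑ d ∈ Icc 1 D with m ∣ d, ∑ n ∈ Icc 1 D with d ∣ n,
        ((moebius (n / d) : ℤ) : ℝ) * selbergDiag D n =
      ∑ n ∈ Icc 1 D with m ∣ n, ∑ d ∈ n.divisors with m ∣ d,
        ((moebius (n / d) : ℤ) : ℝ) * selbergDiag D n := by
    refine sum_comm' fun d n ↦ ?_
    simp only [mem_filter, mem_Icc, Nat.mem_divisors]
    constructor
    · rintro ⟨⟨⟨h1, h2⟩, h3⟩, ⟨h4, h5⟩, h6⟩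
      exact ⟨⟨⟨h6, by omega⟩, h3⟩, ⟨h4, h5⟩, h3.trans h6⟩
    · rintro ⟨⟨⟨h1, h2⟩, h3⟩, ⟨h4, h5⟩, h6⟩
      exact ⟨⟨⟨Nat.pos_of_dvd_of_pos h1 (by omega), (Nat.le_of_dvd (by omega) h1).trans h5⟩, h3⟩,
        ⟨h4, h5⟩, h1⟩
  rw [h2]
  have h3 : ∀ n ∈ (Icc 1 D).filter (m ∣ ·), ∑ d ∈ n.divisors with m ∣ d,
        ((moebius (n / d) : ℤ) : ℝ) * selbergDiag D n = if m = n then selbergDiag D n else 0 := by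
    intro n hn
    simp only [mem_filter, mem_Icc] at hn
    rw [← sum_mul, sum_moebius_div_of_dvd (by omega) hn.2]
    simp
  rw [sum_congr rfl h3, sum_ite_eq]
  simp [mem_Icc.mp hm]

lemma sum_selbergCoeff_mul_div_lcm {D : ℕ} (hD : 1 ≤ D) :
    ∑ d ∈ Icc 1 D, ∑ e ∈ Icc 1 D, selbergCoeff D d * selbergCoeff D e / (d.lcm e : ℝ) =
      (selbergMass D)⁻¹ := by
  have hS := selbergMass_pos hD
  have h1 : ∀ d ∈ Icc 1 D, ∀ e ∈ Icc 1 D,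
      selbergCoeff D d * selbergCoeff D e / (d.lcm e : ℝ) =
        ∑ m ∈ Icc 1 D, (Nat.totient m : ℝ) * ((if m ∣ d then selbergCoeff D d / d else 0) *
          (if m ∣ e then selbergCoeff D e / e else 0)) := by
    intro d hd e he
    rw [mem_Icc] at hd he
    have hg : (d.gcd e : ℝ) = ∑ m ∈ Icc 1 D, if m ∣ d ∧ m ∣ e then (Nat.totient m : ℝ) else 0 := by
      rw [← sum_filter, ← Nat.sum_totient (d.gcd e), Nat.cast_sum]
      refine sum_congr ?_ fun _ _ ↦ rfl
      ext m
      simp only [Nat.mem_divisors, mem_filter, mem_Icc, Nat.dvd_gcd_iff]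
      constructor
      · rintro ⟨⟨h1, h2⟩, -⟩
        exact ⟨⟨Nat.pos_of_dvd_of_pos h1 (by omega), (Nat.le_of_dvd (by omega) h1).trans hd.2⟩,
          h1, h2⟩
      · rintro ⟨-, h1⟩
        exact ⟨h1, Nat.gcd_ne_zero_left (by omega)⟩
    have hd0 : (d : ℝ) ≠ 0 := by exact_mod_cast (by omega : d ≠ 0)
    have he0 : (e : ℝ) ≠ 0 := by exact_mod_cast (by omega : e ≠ 0)
    have hl0 : (d.lcm e : ℝ) ≠ 0 := by
      exact_mod_cast Nat.lcm_ne_zero (by omega) (by omega)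
    have hgl : (d.gcd e : ℝ) * (d.lcm e : ℝ) = d * e := by exact_mod_cast Nat.gcd_mul_lcm d e
    calc _ = (d.gcd e : ℝ) * (selbergCoeff D d / d * (selbergCoeff D e / e)) := by
          field_simp
          linear_combination (-selbergCoeff D d * selbergCoeff D e) * hgl
      _ = _ := by
          rw [hg, sum_mul]
          refine sum_congr rfl fun m _ ↦ ?_
          by_cases h1 : m ∣ d <;> by_cases h2 : m ∣ e <;> simp [h1, h2]
  rw [sum_congr rfl fun d hd ↦ sum_congr rfl (h1 d hd)]
  have h2 : ∑ d ∈ Icc 1 D, ∑ e ∈ Icc 1 D, ∑ m ∈ Icc 1 D, (Nat.totient m : ℝ) *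
        ((if m ∣ d then selbergCoeff D d / d else 0) *
          (if m ∣ e then selbergCoeff D e / e else 0)) =
      ∑ m ∈ Icc 1 D, (Nat.totient m : ℝ) * (selbergDiag D m) ^ 2 := by
    rw [sum_congr rfl fun d _ ↦ sum_comm, sum_comm]
    refine sum_congr rfl fun m hm ↦ ?_
    rw [← sum_selbergCoeff_div hm, sum_filter, sq, sum_mul_sum, mul_sum]
    exact sum_congr rfl fun d _ ↦ by rw [mul_sum]
  rw [h2]
  have h3 : ∀ m ∈ Icc 1 D, (Nat.totient m : ℝ) * (selbergDiag D m) ^ 2 =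
      ((moebius m : ℤ) : ℝ) ^ 2 / Nat.totient m / selbergMass D ^ 2 := by
    intro m hm
    have : (Nat.totient m : ℝ) ≠ 0 := by
      exact_mod_cast (Nat.totient_pos.mpr (mem_Icc.mp hm).1).ne'
    rw [selbergDiag]
    field_simp
  rw [sum_congr rfl h3, ← sum_div, ← selbergMass]
  field_simp

lemma sum_one_div_sq_le_two (D : ℕ) : ∑ b ∈ Icc 1 D, (1 : ℝ) / (b : ℝ) ^ 2 ≤ 2 := by
  rcases Nat.eq_zero_or_pos D with rfl | hD
  · simp
  have := sum_Ioc_inv_sq_le_sub (α := ℝ) (k := 1) (n := D) one_ne_zero hD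
  rw [← insert_Icc_succ_left_eq_Icc hD, sum_insert (by simp)]
  have h2 : Icc (Order.succ 1) D = Ioc 1 D := by ext; simp [Nat.succ_le_iff]
  rw [h2]
  simp only [one_div]
  have h3 : (0 : ℝ) ≤ (D : ℝ)⁻¹ := by positivity
  norm_num at this ⊢
  linarith

lemma log_le_two_mul_selbergMass (D : ℕ) : Real.log (D + 1) ≤ 2 * selbergMass D := by
  have h1 : ∑ k ∈ Icc 1 D, (1 : ℝ) / k ≤
      (∑ m ∈ Icc 1 D, ((moebius m : ℤ) : ℝ) ^ 2 / m) * ∑ b ∈ Icc 1 D, (1 : ℝ) / (b : ℝ) ^ 2 := by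
    rw [sum_mul_sum, ← sum_product']
    choose s t hst hsq using fun k : ℕ ↦ Nat.sq_mul_squarefree k
    have hinj : Set.InjOn (fun k ↦ (s k, t k)) (Icc 1 D : Set ℕ) := by
      intro k _ l _ h
      simp only [Prod.mk.injEq] at h
      rw [← hst k, ← hst l, h.1, h.2]
    calc _ = ∑ k ∈ Icc 1 D, ((moebius (s k) : ℤ) : ℝ) ^ 2 / (s k : ℝ) *
          (1 / ((t k : ℕ) : ℝ) ^ 2) := by
          refine sum_congr rfl fun k _ ↦ ?_
          have h := (hst k).symm
          rw [show ((moebius (s k) : ℤ) : ℝ) ^ 2 = 1 by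
            exact_mod_cast moebius_sq_eq_one_of_squarefree (hsq k)]
          nth_rw 1 [h]
          push_cast
          rw [div_mul_div_comm, mul_comm ((t k : ℝ) ^ 2), mul_one]
      _ = ∑ x ∈ (Icc 1 D).image (fun k ↦ (s k, t k)), ((moebius x.1 : ℤ) : ℝ) ^ 2 / (x.1 : ℝ) *
          (1 / (x.2 : ℝ) ^ 2) := by rw [sum_image hinj]
      _ ≤ _ := by
          refine sum_le_sum_of_subset_of_nonneg ?_ fun _ _ _ ↦ by positivity
          intro x hx
          obtain ⟨k, hk, rfl⟩ := mem_image.mp hx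
          have h := hst k
          simp only [mem_Icc, mem_product] at hk ⊢
          have hk0 : 0 < t k ^ 2 * s k := by omega
          have hs : 0 < s k := Nat.pos_of_mul_pos_left hk0
          have ht : 0 < t k := by
            rcases Nat.eq_zero_or_pos (t k) with h0 | h0
            · simp [h0] at hk0
            · exact h0
          refine ⟨⟨hs, ?_⟩, ht, ?_⟩
          · nlinarith [Nat.pow_pos (n := 2) ht]
          · nlinarith
  have h2 : ∑ m ∈ Icc 1 D, ((moebius m : ℤ) : ℝ) ^ 2 / m ≤ selbergMass D := by
    refine sum_le_sum fun m hm ↦ ?_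
    have : 0 < Nat.totient m := Nat.totient_pos.mpr (mem_Icc.mp hm).1
    have : (0 : ℝ) < Nat.totient m := by exact_mod_cast this
    gcongr
    exact Nat.totient_le m
  have h3 : Real.log (D + 1) ≤ ∑ k ∈ Icc 1 D, (1 : ℝ) / k := by
    have := log_add_one_le_harmonic D
    rw [harmonic_eq_sum_Icc] at this
    push_cast at this
    simpa using this
  have h4 := sum_one_div_sq_le_two D
  have h5 : 0 ≤ ∑ m ∈ Icc 1 D, ((moebius m : ℤ) : ℝ) ^ 2 / m := sum_nonneg fun _ _ ↦ by positivity
  have h6 : (0 : ℝ) ≤ ∑ b ∈ Icc 1 D, (1 : ℝ) / (b : ℝ) ^ 2 := sum_nonneg fun _ _ ↦ by positivity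
  nlinarith

lemma selbergMajorant_eq_one {D p : ℕ} (hD : 1 ≤ D) (hp : p.Prime) (hDp : D < p) :
    selbergMajorant D p = 1 := by
  have : (Icc 1 D).filter (· ∣ p) = {1} := by
    ext d
    simp only [mem_filter, mem_Icc, mem_singleton, Nat.dvd_prime hp]
    omega
  rw [selbergMajorant, this, sum_singleton, selbergCoeff_one hD, one_pow]

lemma sum_Ioc_dvd {M : Type*} [AddCommMonoid M] (a b : ℕ) {l : ℕ} (hl : 0 < l) (g : ℕ → M) :
    ∑ k ∈ Ioc a b with l ∣ k, g k = ∑ j ∈ Ioc (a / l) (b / l), g (l * j) := by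
  symm
  refine sum_bij' (fun j _ ↦ l * j) (fun k _ ↦ k / l) ?_ ?_ ?_ ?_ ?_
  · intro j hj
    rw [mem_Ioc, Nat.div_lt_iff_lt_mul hl, Nat.le_div_iff_mul_le hl, mul_comm] at hj
    simpa [mem_filter, mem_Ioc] using hj
  · intro k hk
    simp only [mem_filter, mem_Ioc] at hk
    obtain ⟨⟨h1, h2⟩, j, rfl⟩ := hk
    rw [Nat.mul_div_cancel_left _ hl, mem_Ioc, Nat.div_lt_iff_lt_mul hl, Nat.le_div_iff_mul_le hl,
      mul_comm]
    exact ⟨h1, h2⟩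
  · intro j _; exact Nat.mul_div_cancel_left _ hl
  · intro k hk; exact Nat.mul_div_cancel' (mem_filter.mp hk).2
  · intro _ _; rfl

lemma sum_selbergMajorant_mul (D : ℕ) (s : Finset ℕ) (g : ℕ → ℝ) :
    ∑ k ∈ s, selbergMajorant D k * g k = ∑ d ∈ Icc 1 D, ∑ e ∈ Icc 1 D,
      selbergCoeff D d * selbergCoeff D e * ∑ k ∈ s with d.lcm e ∣ k, g k := by
  have h1 : ∀ k ∈ s, selbergMajorant D k * g k = ∑ d ∈ Icc 1 D, ∑ e ∈ Icc 1 D,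
      selbergCoeff D d * selbergCoeff D e * if d.lcm e ∣ k then g k else 0 := by
    intro k _
    rw [selbergMajorant, sum_filter, sq, sum_mul_sum, sum_mul]
    refine sum_congr rfl fun d _ ↦ ?_
    rw [sum_mul]
    refine sum_congr rfl fun e _ ↦ ?_
    by_cases hd : d ∣ k <;> by_cases he : e ∣ k <;> simp [hd, he, Nat.lcm_dvd_iff]
  rw [sum_congr rfl h1, sum_comm]
  refine sum_congr rfl fun d _ ↦ ?_
  rw [sum_comm]
  refine sum_congr rfl fun e _ ↦ ?_
  rw [← mul_sum, sum_filter]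

lemma sum_abs_selbergCoeff_mul_le {D : ℕ} (hD : 1 ≤ D) :
    ∑ d ∈ Icc 1 D, ∑ e ∈ Icc 1 D, |selbergCoeff D d * selbergCoeff D e| ≤ (D : ℝ) ^ 4 := by
  have h : ∑ d ∈ Icc 1 D, |selbergCoeff D d| ≤ (D : ℝ) ^ 2 := by
    calc _ ≤ ∑ d ∈ Icc 1 D, (D : ℝ) := sum_le_sum fun d hd ↦
          (abs_selbergCoeff_le hD d).trans (by exact_mod_cast (mem_Icc.mp hd).2)
      _ = _ := by simp [sq]
  have h0 : 0 ≤ ∑ d ∈ Icc 1 D, |selbergCoeff D d| := sum_nonneg fun _ _ ↦ abs_nonneg _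
  simp only [abs_mul]
  rw [← sum_mul_sum]
  nlinarith

lemma sum_selbergMajorant_le {D : ℕ} (hD : 1 ≤ D) {a b : ℕ} (hab : a ≤ b) :
    ∑ k ∈ Ioc a b, selbergMajorant D k ≤ ((b : ℝ) - a) / selbergMass D + (D : ℝ) ^ 4 := by
  have h1 := sum_selbergMajorant_mul D (Ioc a b) (fun _ ↦ 1)
  simp only [mul_one] at h1
  rw [h1, div_eq_mul_inv, ← sum_selbergCoeff_mul_div_lcm hD, mul_sum]
  refine le_trans ?_ (add_le_add_right (sum_abs_selbergCoeff_mul_le hD) _)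
  rw [← sum_add_distrib]
  refine sum_le_sum fun d hd ↦ ?_
  rw [mul_sum, ← sum_add_distrib]
  refine sum_le_sum fun e he ↦ ?_
  rw [mem_Icc] at hd he
  have hl : 0 < d.lcm e := Nat.lcm_pos hd.1 he.1
  rw [sum_Ioc_dvd a b hl]
  simp only [sum_const, Nat.card_Ioc, nsmul_eq_mul, mul_one]
  set l := d.lcm e
  have hl' : (0 : ℝ) < l := by exact_mod_cast hl
  have key : |((b / l - a / l : ℕ) : ℝ) - ((b : ℝ) - a) / l| ≤ 1 := by
    rw [Nat.cast_sub (Nat.div_le_div_right hab)]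
    have ha := Nat.cast_div_le (α := ℝ) (m := a) (n := l)
    have hb := Nat.cast_div_le (α := ℝ) (m := b) (n := l)
    have ha' : (a : ℝ) / l < (a / l : ℕ) + 1 := by
      rw [div_lt_iff₀ hl']; exact_mod_cast (by rw [mul_comm]; exact Nat.lt_mul_div_succ a hl)
    have hb' : (b : ℝ) / l < (b / l : ℕ) + 1 := by
      rw [div_lt_iff₀ hl']; exact_mod_cast (by rw [mul_comm]; exact Nat.lt_mul_div_succ b hl)
    rw [sub_div, abs_le]
    constructor <;> linarith
  set c := selbergCoeff D d * selbergCoeff D e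
  have : c * (((b / l - a / l : ℕ) : ℝ) - ((b : ℝ) - a) / l) ≤ |c| := by
    refine (le_abs_self _).trans ?_
    rw [abs_mul]
    exact mul_le_of_le_one_right (abs_nonneg _) key
  have h3 : ((b : ℝ) - a) * (c / l) = c * (((b : ℝ) - a) / l) := by ring
  rw [h3]
  linarith

lemma abs_sum_Ioc_le_of_periodic {g : ℕ → ℝ} {q : ℕ} (hq : 0 < q) (hper : ∀ k, g (k + q) = g k)
    (hsum : ∑ k ∈ range q, g k = 0) (hg : ∀ k, |g k| ≤ 1) (a b : ℕ) :
    |∑ k ∈ Ioc a b, g k| ≤ q := by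
  have hshift : ∀ a, ∑ k ∈ range q, g (a + k) = 0 := by
    intro a
    induction a with
    | zero => simpa using hsum
    | succ a ih =>
      have h1 := sum_range_succ (fun k ↦ g (a + k)) q
      have h2 := sum_range_succ' (fun k ↦ g (a + k)) q
      simp only [add_zero] at h2
      rw [hper, ih] at h1
      have h3 : ∀ k, g (a + 1 + k) = g (a + (k + 1)) := fun k ↦ by congr 1; ring
      simp only [h3]
      linarith
  have key : ∀ n a, |∑ k ∈ range n, g (a + k)| ≤ q := by
    intro n
    induction n using Nat.strong_induction_on with
    | _ n ih =>
      intro a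
      rcases le_or_gt q n with h | h
      · obtain ⟨m, rfl⟩ := Nat.exists_eq_add_of_le h
        rw [sum_range_add, hshift, zero_add]
        simpa only [add_assoc] using ih m (by omega) (a + q)
      · calc _ ≤ ∑ k ∈ range n, |g (a + k)| := abs_sum_le_sum_abs _ _
          _ ≤ ∑ k ∈ range n, (1 : ℝ) := sum_le_sum fun _ _ ↦ hg _
          _ = n := by simp
          _ ≤ q := by exact_mod_cast h.le
  have h2 : Ioc a b = Ico (a + 1) (b + 1) := by ext; simp
  rw [h2, sum_Ico_eq_sum_range]
  exact key _ _

lemma abs_sum_selbergMajorant_mul_le {D : ℕ} (hD : 1 ≤ D) {g : ℕ → ℝ} {q : ℕ} (hq : 0 < q)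
    (hmul : ∀ k l, g (k * l) = g k * g l) (hper : ∀ k, g (k + q) = g k)
    (hsum : ∑ k ∈ range q, g k = 0) (hg : ∀ k, |g k| ≤ 1) (a b : ℕ) :
    |∑ k ∈ Ioc a b, selbergMajorant D k * g k| ≤ (D : ℝ) ^ 4 * q := by
  rw [sum_selbergMajorant_mul]
  refine (abs_sum_le_sum_abs _ _).trans ((sum_le_sum fun d _ ↦ abs_sum_le_sum_abs _ _).trans ?_)
  refine le_trans ?_ (mul_le_mul_of_nonneg_right (sum_abs_selbergCoeff_mul_le hD) (by positivity))
  rw [sum_mul]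
  refine sum_le_sum fun d hd ↦ ?_
  rw [sum_mul]
  refine sum_le_sum fun e he ↦ ?_
  rw [mem_Icc] at hd he
  rw [abs_mul]
  refine mul_le_mul_of_nonneg_left ?_ (abs_nonneg _)
  rw [sum_Ioc_dvd a b (Nat.lcm_pos hd.1 he.1)]
  simp only [hmul, ← mul_sum]
  rw [abs_mul]
  refine (mul_le_of_le_one_left (abs_nonneg _) (hg _)).trans ?_
  exact abs_sum_Ioc_le_of_periodic hq hper hsum hg _ _

/-- A second moment bound for the number of primes at which a family of characters is constant. -/
lemma card_mul_sq_le_of_characters {ι : Type*} (I : Finset ι) (ψ : ι → ℕ → ℝ)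
    (hψ : ∀ i k, |ψ i k| ≤ 1) {q₀ : ℝ} (hq₀ : 0 ≤ q₀)
    (hmul : ∀ i ∈ I, ∀ k l, ψ i (k * l) = ψ i k * ψ i l)
    (hper : ∀ i ∈ I, ∀ j ∈ I, i ≠ j → ∃ q : ℕ, 0 < q ∧ (q : ℝ) ≤ q₀ ∧
      (∀ k, ψ i (k + q) * ψ j (k + q) = ψ i k * ψ j k) ∧ ∑ k ∈ range q, ψ i k * ψ j k = 0)
    {D : ℕ} (hD : 1 ≤ D) {a b : ℕ} (hab : a ≤ b) (P : Finset ℕ) (hP : P ⊆ Ioc a b)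
    (hprime : ∀ p ∈ P, p.Prime ∧ D < p) (hconst : ∀ p ∈ P, (∑ i ∈ I, ψ i p) ^ 2 = (#I : ℝ) ^ 2) :
    (#P : ℝ) * (#I : ℝ) ^ 2 ≤
      #I * (((b : ℝ) - a) / selbergMass D + (D : ℝ) ^ 4) + (#I : ℝ) ^ 2 * ((D : ℝ) ^ 4 * q₀) := by
  classical
  have hw : ∀ k, 0 ≤ selbergMajorant D k := fun k ↦ sq_nonneg _
  have hE := sum_selbergMajorant_le hD hab
  calc (#P : ℝ) * (#I : ℝ) ^ 2
      = ∑ k ∈ P, selbergMajorant D k * (∑ i ∈ I, ψ i k) ^ 2 := by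
        rw [sum_congr rfl fun p hp ↦ by
          rw [hconst p hp, selbergMajorant_eq_one hD (hprime p hp).1 (hprime p hp).2, one_mul]]
        simp
    _ ≤ ∑ k ∈ Ioc a b, selbergMajorant D k * (∑ i ∈ I, ψ i k) ^ 2 :=
        sum_le_sum_of_subset_of_nonneg hP fun k _ _ ↦ mul_nonneg (hw k) (sq_nonneg _)
    _ = ∑ i ∈ I, ∑ j ∈ I, ∑ k ∈ Ioc a b, selbergMajorant D k * (ψ i k * ψ j k) := by
        rw [sum_congr rfl fun k _ ↦ by rw [sq, sum_mul_sum, mul_sum], sum_comm]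
        refine sum_congr rfl fun i _ ↦ ?_
        rw [sum_congr rfl fun k _ ↦ mul_sum _ _ _, sum_comm]
    _ ≤ ∑ i ∈ I, ∑ j ∈ I, ((if i = j then ((b : ℝ) - a) / selbergMass D + (D : ℝ) ^ 4 else 0) +
          (D : ℝ) ^ 4 * q₀) := by
        refine sum_le_sum fun i hi ↦ sum_le_sum fun j hj ↦ ?_
        by_cases hij : i = j
        · subst hij
          rw [if_pos rfl]
          have : ∑ k ∈ Ioc a b, selbergMajorant D k * (ψ i k * ψ i k) ≤
              ∑ k ∈ Ioc a b, selbergMajorant D k := by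
            refine sum_le_sum fun k _ ↦ mul_le_of_le_one_right (hw k) ?_
            rw [← sq, ← sq_abs]
            exact pow_le_one₀ (abs_nonneg _) (hψ i k)
          have : 0 ≤ (D : ℝ) ^ 4 * q₀ := by positivity
          linarith
        · rw [if_neg hij, zero_add]
          obtain ⟨q, hq, hqq, hp, hs⟩ := hper i hi j hj hij
          refine (le_abs_self _).trans ((abs_sum_selbergMajorant_mul_le hD hq
            (g := fun k ↦ ψ i k * ψ j k) ?_ hp hs ?_ a b).trans ?_)
          · intro k l; simp only [hmul i hi, hmul j hj]; ring
          · intro k; rw [abs_mul]; exact mul_le_one₀ (hψ i k) (abs_nonneg _) (hψ j k)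
          · gcongr
    _ = _ := by
        simp only [sum_add_distrib, sum_ite_eq, sum_const, nsmul_eq_mul]
        rw [sum_congr rfl fun i hi ↦ if_pos hi]
        simp only [sum_const, nsmul_eq_mul]
        ring

end SelbergSieve

section OddJacobi

open Finset

/-- The Jacobi symbol `J(A | k)` as a function of odd `k`, extended by zero to even `k`. -/
noncomputable def oddJacobi (A : ℤ) (k : ℕ) : ℝ :=
  if Even k then 0 else (jacobiSym A k : ℝ)

lemma abs_oddJacobi_le_one (A : ℤ) (k : ℕ) : |oddJacobi A k| ≤ 1 := by
  unfold oddJacobi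
  split_ifs
  · simp
  · rcases jacobiSym.trichotomy A k with h | h | h <;> simp [h]

lemma oddJacobi_mul_right (A : ℤ) (k l : ℕ) :
    oddJacobi A (k * l) = oddJacobi A k * oddJacobi A l := by
  unfold oddJacobi
  by_cases hk : Even k
  · simp [hk]
  by_cases hl : Even l
  · simp [hl]
  have hk0 : k ≠ 0 := by rintro rfl; simp at hk
  have hl0 : l ≠ 0 := by rintro rfl; simp at hl
  simp [Nat.even_mul, hk, hl, jacobiSym.mul_right' A hk0 hl0]

lemma oddJacobi_mul_left (A B : ℤ) (k : ℕ) :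
    oddJacobi (A * B) k = oddJacobi A k * oddJacobi B k := by
  unfold oddJacobi
  split_ifs <;> simp [jacobiSym.mul_left]

lemma oddJacobi_add_period (A : ℤ) (k : ℕ) :
    oddJacobi A (k + 4 * A.natAbs) = oddJacobi A k := by
  have h4 : Even (4 * A.natAbs) := ⟨2 * A.natAbs, by ring⟩
  unfold oddJacobi
  simp only [Nat.even_add, h4, iff_true]
  split_ifs with hk
  · rfl
  · have hk' := Nat.not_even_iff_odd.mp hk
    rw [jacobiSym.mod_right A hk', jacobiSym.mod_right A (hk'.add_even h4), Nat.add_mod_right]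

lemma sum_oddJacobi_eq_zero {A : ℤ} (hA : A ≠ 0) {k₀ : ℕ} (hk₀ : oddJacobi A k₀ = -1) :
    ∑ k ∈ range (4 * A.natAbs), oddJacobi A k = 0 := by
  set q := 4 * A.natAbs with hq
  have hA0 : A.natAbs ≠ 0 := Int.natAbs_ne_zero.mpr hA
  have : NeZero q := ⟨by omega⟩
  have hodd : ¬ Even k₀ := by
    intro h
    rw [oddJacobi, if_pos h] at hk₀
    norm_num at hk₀
  have hcop : k₀.Coprime q := by
    refine Nat.Coprime.mul_right ?_ ?_
    · have := Nat.not_even_iff_odd.mp hodd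
      exact (Nat.Coprime.pow_right 2 (Nat.coprime_two_right.mpr this) : k₀.Coprime (2 ^ 2))
    · have h1 : jacobiSym A k₀ ≠ 0 := by
        intro h
        rw [oddJacobi, if_neg hodd, h] at hk₀
        norm_num at hk₀
      have : NeZero k₀ := ⟨by rintro rfl; simp at hodd⟩
      rw [Ne, jacobiSym.eq_zero_iff_not_coprime, not_not] at h1
      rw [Nat.coprime_comm]
      simpa [Int.gcd] using h1
  have hmod : ∀ m, oddJacobi A (m % q) = oddJacobi A m := fun m ↦
    Function.Periodic.map_mod_nat (oddJacobi_add_period A) m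
  have h1 : ∑ k ∈ range q, oddJacobi A k = ∑ x : ZMod q, oddJacobi A x.val := by
    symm
    refine sum_bij' (fun x _ ↦ x.val) (fun k _ ↦ (k : ZMod q)) ?_ ?_ ?_ ?_ ?_
    · intro x _; exact mem_range.mpr x.val_lt
    · intro _ _; exact mem_univ _
    · intro x _; exact ZMod.natCast_zmod_val x
    · intro k hk; exact ZMod.val_cast_of_lt (mem_range.mp hk)
    · intro _ _; rfl
  have h2 : ∑ x : ZMod q, oddJacobi A x.val =
      ∑ x : ZMod q, oddJacobi A (ZMod.unitOfCoprime k₀ hcop * x : ZMod q).val :=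
    (Equiv.sum_comp (Units.mulLeft (ZMod.unitOfCoprime k₀ hcop)) fun x ↦ oddJacobi A x.val).symm
  have h3 : ∀ x : ZMod q, oddJacobi A (ZMod.unitOfCoprime k₀ hcop * x : ZMod q).val =
      - oddJacobi A x.val := by
    intro x
    rw [ZMod.coe_unitOfCoprime, ZMod.val_mul, hmod, oddJacobi_mul_right, ZMod.val_natCast, hmod,
      hk₀, neg_one_mul]
  simp only [h3, sum_neg_distrib] at h2
  rw [h1]
  linarith

lemma exists_oddJacobi_eq_neg_one {A : ℤ} (hA : A ≠ 0) {p : ℕ} (hp : p.Prime) (hp2 : p ≠ 2)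
    (hodd : Odd (padicValInt p A)) : ∃ k, oddJacobi A k = -1 := by
  have : Fact p.Prime := ⟨hp⟩
  obtain ⟨A', hA', hpA'⟩ : ∃ A', A = p ^ padicValInt p A * A' ∧ ¬ (p : ℤ) ∣ A' := by
    obtain ⟨A', h⟩ := padicValInt_dvd (p := p) A
    refine ⟨A', h, ?_⟩
    rintro ⟨c, rfl⟩
    have h1 : (p : ℤ) ^ (padicValInt p A + 1) ∣ A := ⟨c, by rw [pow_succ, mul_assoc]; exact h⟩
    rw [padicValInt_dvd_iff] at h1
    omega
  have hA'0 : A' ≠ 0 := by rintro rfl; simp at hpA'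
  have hA'n : A'.natAbs ≠ 0 := Int.natAbs_ne_zero.mpr hA'0
  obtain ⟨r, hr⟩ := quadraticChar_exists_neg_one (F := ZMod p) (by rwa [ZMod.ringChar_zmod_n])
  have hcop : Nat.Coprime (4 * A'.natAbs) p := by
    refine Nat.Coprime.mul_left ?_ ?_
    · exact (Nat.Coprime.pow_left 2 ((Nat.coprime_primes Nat.prime_two hp).mpr hp2.symm) :
        (2 ^ 2).Coprime p)
    · rw [Nat.coprime_comm, hp.coprime_iff_not_dvd]
      rwa [Int.natCast_dvd] at hpA'
  obtain ⟨k, hk1, hk2⟩ := Nat.chineseRemainder hcop 1 r.val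
  have hk4 : k % 4 = 1 := (hk1.of_mul_right _ : k ≡ 1 [MOD 4])
  have hkodd : Odd k := Nat.odd_iff.mpr (by omega)
  refine ⟨k, ?_⟩
  rw [oddJacobi, if_neg (Nat.not_even_iff_odd.mpr hkodd)]
  have h1 : jacobiSym A' k = 1 := by
    rw [jacobiSym.mod_right A' hkodd, hk1, Nat.mod_eq_of_lt (by omega), jacobiSym.one_right]
  have h2 : jacobiSym p k = -1 := by
    rw [← jacobiSym.quadratic_reciprocity_one_mod_four hk4 (hp.odd_of_ne_two hp2),
      ← jacobiSym.legendreSym.to_jacobiSym, legendreSym]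
    rw [← hr]
    congr 1
    have := (ZMod.natCast_eq_natCast_iff k r.val p).mpr hk2
    simpa using this
  rw [hA', jacobiSym.mul_left, jacobiSym.pow_left, h1, h2, hodd.neg_one_pow]
  norm_num

lemma oddJacobi_prime (A : ℤ) {p : ℕ} [Fact p.Prime] (hp : p ≠ 2) :
    oddJacobi A p = legendreSym p A := by
  rw [oddJacobi, if_neg, jacobiSym.legendreSym.to_jacobiSym]
  exact Nat.not_even_iff_odd.mpr ((Fact.out : p.Prime).odd_of_ne_two hp)

/-- A family of integers whose pairwise products have odd valuation at some odd prime has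
simultaneously constant quadratic character at few primes. -/
lemma card_mul_sq_le_of_legendreSym {ι : Type*} (I : Finset ι) (A : ι → ℤ) {M : ℝ}
    (hM : ∀ i ∈ I, |(A i : ℝ)| ≤ M) (hA : ∀ i ∈ I, A i ≠ 0)
    (hval : ∀ i ∈ I, ∀ j ∈ I, i ≠ j →
      ∃ p : ℕ, p.Prime ∧ p ≠ 2 ∧ Odd (padicValInt p (A i * A j)))
    {D : ℕ} (hD : 2 ≤ D) {a b : ℕ} (hab : a ≤ b) (P : Finset ℕ) (hP : P ⊆ Ioc a b)
    (hprime : ∀ p ∈ P, p.Prime ∧ D < p)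
    (hconst : ∀ p ∈ P, ∃ ε : ℤ, ε ^ 2 = 1 ∧ ∀ i ∈ I, ∀ [Fact p.Prime], legendreSym p (A i) = ε) :
    (#P : ℝ) * (#I : ℝ) ^ 2 ≤ #I * (((b : ℝ) - a) / selbergMass D + (D : ℝ) ^ 4) +
      (#I : ℝ) ^ 2 * ((D : ℝ) ^ 4 * (4 * M ^ 2)) := by
  refine card_mul_sq_le_of_characters I (fun i ↦ oddJacobi (A i))
    (fun i k ↦ abs_oddJacobi_le_one _ _) (by positivity)
    (fun i _ k l ↦ oddJacobi_mul_right _ _ _) ?_ (by omega) hab P hP hprime ?_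
  · intro i hi j hj hij
    have h0 := mul_ne_zero (hA i hi) (hA j hj)
    obtain ⟨p, hp, hp2, hodd⟩ := hval i hi j hj hij
    obtain ⟨k₀, hk₀⟩ := exists_oddJacobi_eq_neg_one h0 hp hp2 hodd
    have h1 : (A i * A j).natAbs ≠ 0 := Int.natAbs_ne_zero.mpr h0
    refine ⟨4 * (A i * A j).natAbs, by omega, ?_, fun k ↦ ?_, ?_⟩
    · push_cast
      rw [Nat.cast_natAbs, abs_mul]
      push_cast
      have := mul_le_mul (hM i hi) (hM j hj) (abs_nonneg _) ((abs_nonneg _).trans (hM i hi))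
      linarith
    · simp only [← oddJacobi_mul_left, oddJacobi_add_period]
    · simp only [← oddJacobi_mul_left]
      exact sum_oddJacobi_eq_zero h0 hk₀
  · intro p hp
    obtain ⟨hpp, hDp⟩ := hprime p hp
    have : Fact p.Prime := ⟨hpp⟩
    obtain ⟨ε, hε, h⟩ := hconst p hp
    rw [sum_congr rfl fun i hi ↦ by rw [oddJacobi_prime _ (by omega), h i hi]]
    rw [sum_const, nsmul_eq_mul, mul_pow]
    norm_cast
    rw [hε, mul_one]

end OddJacobi

section Runge

open Finset

/-- A polynomial of degree `2 * D` whose leading coefficient is a square is the square of a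
polynomial up to a remainder of degree less than `D`. -/
lemma exists_sub_sq_coeff_eq_zero {K : Type*} [Field K] [CharZero K] {F : K[X]} {a : K} {D : ℕ}
    (ha : a ≠ 0) (hF : F.natDegree ≤ 2 * D) (hlc : F.coeff (2 * D) = a ^ 2) :
    ∃ G : K[X], (∀ m, D ≤ m → (G - C a * X ^ D).coeff m = 0) ∧
      ∀ m, D ≤ m → (F - G ^ 2).coeff m = 0 := by
  suffices h : ∀ k ≤ D, ∃ G : K[X], (∀ m, D ≤ m → (G - C a * X ^ D).coeff m = 0) ∧
      ∀ m, 2 * D - k ≤ m → (F - G ^ 2).coeff m = 0 by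
    obtain ⟨G, h1, h2⟩ := h D le_rfl
    exact ⟨G, h1, fun m hm ↦ h2 m (by omega)⟩
  intro k
  induction k with
  | zero =>
    refine fun _ ↦ ⟨C a * X ^ D, by simp, fun m hm ↦ ?_⟩
    rw [mul_pow, ← C_pow, ← pow_mul, coeff_sub, coeff_C_mul, coeff_X_pow, mul_comm D]
    rcases hm.eq_or_lt with rfl | hm
    · simp [hlc]
    · rw [coeff_eq_zero_of_natDegree_lt (by omega), if_neg (by omega)]; simp
  | succ k ih =>
    intro hk
    obtain ⟨G, h1, h2⟩ := ih (by omega)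
    set e := (F - G ^ 2).coeff (2 * D - (k + 1))
    have hG : ∀ m, D ≤ m → G.coeff m = if m = D then a else 0 := by
      intro m hm
      have := h1 m hm
      rwa [coeff_sub, coeff_C_mul, coeff_X_pow, mul_ite, mul_one, mul_zero, sub_eq_zero] at this
    refine ⟨G + C (e / (2 * a)) * X ^ (D - (k + 1)), fun m hm ↦ ?_, fun m hm ↦ ?_⟩
    · rw [add_sub_right_comm, coeff_add, h1 m hm, coeff_C_mul, coeff_X_pow, if_neg (by omega)]
      simp
    · have h3 : F - (G + C (e / (2 * a)) * X ^ (D - (k + 1))) ^ 2 =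
          (F - G ^ 2) - C (2 * (e / (2 * a))) * (G * X ^ (D - (k + 1))) -
            C ((e / (2 * a)) ^ 2) * X ^ (2 * (D - (k + 1))) := by
        simp only [C_mul, C_pow, C_ofNat]; ring
      rw [h3, coeff_sub, coeff_sub, coeff_C_mul, coeff_C_mul, coeff_X_pow, if_neg (by omega),
        coeff_mul_X_pow', if_pos (by omega), hG _ (by omega)]
      rcases hm.eq_or_lt with rfl | hm
      · rw [if_pos (by omega)]
        change e - _ - _ = 0
        field_simp
        ring
      · rw [h2 m (by omega), if_neg (by omega)]; simp

/-- An absolute value grows polynomially on the values of a polynomial. -/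
lemma exists_abv_eval_le (v : AbsoluteValue ℚ ℝ) (F : ℚ[X]) :
    ∃ c : ℝ, 0 ≤ c ∧ ∀ n, F.natDegree ≤ n → ∀ x, v (F.eval x) ≤ c * max 1 (v x) ^ n := by
  refine ⟨∑ i ∈ range (F.natDegree + 1), v (F.coeff i), sum_nonneg fun _ _ ↦ v.nonneg _, ?_⟩
  intro n hn x
  rw [eval_eq_sum_range, sum_mul]
  refine (v.sum_le _ _).trans (sum_le_sum fun i hi ↦ ?_)
  rw [map_mul, map_pow]
  refine mul_le_mul_of_nonneg_left ?_ (v.nonneg _)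
  have := mem_range.mp hi
  calc v x ^ i ≤ max 1 (v x) ^ i := pow_le_pow_left₀ (v.nonneg _) (le_max_right _ _) _
    _ ≤ _ := pow_le_pow_right₀ (le_max_left _ _) (by omega)

lemma exists_abv_eval_le_of_coeff_eq_zero (v : AbsoluteValue ℚ ℝ) {F : ℚ[X]} {n : ℕ}
    (hn : 0 < n) (hF : ∀ m, n ≤ m → F.coeff m = 0) :
    ∃ c : ℝ, 0 ≤ c ∧ ∀ x, 1 ≤ v x → v (F.eval x) * v x ≤ c * v x ^ n := by
  obtain ⟨c, hc, h⟩ := exists_abv_eval_le v F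
  refine ⟨c, hc, fun x hx ↦ ?_⟩
  have h1 := h (n - 1) (natDegree_le_iff_coeff_eq_zero.mpr fun m hm ↦ hF m (by omega)) x
  rw [max_eq_right hx] at h1
  calc _ ≤ c * v x ^ (n - 1) * v x := mul_le_mul_of_nonneg_right h1 (v.nonneg _)
    _ = _ := by rw [mul_assoc, ← pow_succ, Nat.sub_add_cancel hn]

lemma exists_abv_sub_mul_max_le (v : AbsoluteValue ℚ ℝ) {F G : ℚ[X]} {a : ℚ} {D : ℕ} (hD : 0 < D)
    (ha : a ≠ 0) (hG : ∀ m, D ≤ m → (G - C a * X ^ D).coeff m = 0)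
    (hFG : ∀ m, D ≤ m → (F - G ^ 2).coeff m = 0) :
    ∃ L₀ : ℝ, ∀ L, L₀ ≤ L → ∃ c : ℝ, ∀ x y : ℚ, y ^ 2 = F.eval x →
      (L ≤ v x → v (y - a * x ^ D) ≤ v 2 / 2 * v (a * x ^ D)) →
      v (y - G.eval x) * max 1 (v x) ≤ c := by
  have h2 : 0 < v 2 := v.pos two_ne_zero
  have hva : 0 < v a := v.pos ha
  obtain ⟨c₁, hc₁, h₁⟩ := exists_abv_eval_le_of_coeff_eq_zero v hD hG
  obtain ⟨c₂, hc₂, h₂⟩ := exists_abv_eval_le_of_coeff_eq_zero v hD hFG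
  obtain ⟨c₃, hc₃, h₃⟩ := exists_abv_eval_le v F
  obtain ⟨c₄, hc₄, h₄⟩ := exists_abv_eval_le v G
  refine ⟨max 1 (4 * c₁ / (v 2 * v a)), fun L hL ↦ ?_⟩
  rw [max_le_iff] at hL
  refine ⟨max (4 * c₂ / (v 2 * v a))
    (((1 + c₃ * L ^ F.natDegree) + c₄ * L ^ G.natDegree) * L), fun x y hy hclose ↦ ?_⟩
  rcases le_or_gt L (v x) with hx | hx
  · refine le_trans ?_ (le_max_left _ _)
    have hx1 : 1 ≤ v x := hL.1.trans hx
    have hx0 : 0 < v x ^ D := by positivity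
    rw [max_eq_right hx1]
    have h5 := hclose hx
    have h6 := h₁ x hx1
    have h7 := h₂ x hx1
    simp only [eval_sub, eval_mul, eval_C, eval_pow, eval_X] at h6 h7
    rw [map_mul, map_pow] at h5
    have h8 : v (eval x G - a * x ^ D) ≤ v 2 / 4 * (v a * v x ^ D) := by
      have h9 : 4 * c₁ ≤ v x * (v 2 * v a) := by
        rw [← div_le_iff₀ (by positivity)]; exact hL.2.trans hx
      have : v (eval x G - a * x ^ D) * v x ≤ v 2 / 4 * (v a * v x ^ D) * v x := by
        nlinarith
      exact le_of_mul_le_mul_right this (by linarith)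
    have h9 : v 2 / 4 * (v a * v x ^ D) ≤ v (y + eval x G) := by
      have h10 : 2 * (a * x ^ D) =
          (y + eval x G) - (y - a * x ^ D) - (eval x G - a * x ^ D) := by ring
      have h11 : v 2 * (v a * v x ^ D) ≤
          v (y + eval x G) + v (y - a * x ^ D) + v (eval x G - a * x ^ D) := by
        rw [← map_pow, ← map_mul, ← map_mul, h10]
        refine (v.sub_le_add _ _).trans ?_
        gcongr
        exact v.sub_le_add _ _
      linarith
    have h10 : v (y - eval x G) * v (y + eval x G) = v (eval x F - eval x G ^ 2) := by
      rw [← map_mul, ← hy]; congr 1; ring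
    rw [le_div_iff₀ (by positivity)]
    have h11 : v (y - eval x G) * (v 2 / 4 * (v a * v x ^ D)) * v x ≤ c₂ * v x ^ D := by
      refine le_trans ?_ h7
      rw [← h10]
      exact mul_le_mul_of_nonneg_right (mul_le_mul_of_nonneg_left h9 (v.nonneg _)) (v.nonneg _)
    have h12 : v (y - eval x G) * v x * (v 2 * v a) * v x ^ D ≤ 4 * c₂ * v x ^ D := by
      linarith
    exact le_of_mul_le_mul_right h12 hx0
  · refine le_trans ?_ (le_max_right _ _)
    have hm : max 1 (v x) ≤ L := max_le hL.1 hx.le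
    have hm0 : 0 ≤ max 1 (v x) := le_trans zero_le_one (le_max_left _ _)
    have h5 : v y ^ 2 ≤ c₃ * L ^ F.natDegree := by
      rw [← map_pow, hy]
      exact (h₃ _ le_rfl x).trans (by gcongr)
    have h6 : v y ≤ 1 + c₃ * L ^ F.natDegree := by nlinarith [sq_nonneg (v y - 1), v.nonneg y]
    have h7 : v (eval x G) ≤ c₄ * L ^ G.natDegree := (h₄ _ le_rfl x).trans (by gcongr)
    have h8 := v.sub_le_add y (eval x G)
    exact mul_le_mul (by linarith) hm hm0 (by linarith [v.nonneg y, v.nonneg (eval x G)])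

lemma exists_nat_mul_eval_mem (R : Subring ℚ) (G : ℚ[X]) :
    ∃ N : ℕ, N ≠ 0 ∧ ∀ x ∈ R, (N : ℚ) * G.eval x ∈ R := by
  refine ⟨∏ i ∈ range (G.natDegree + 1), (G.coeff i).den,
    prod_ne_zero_iff.mpr fun i _ ↦ (G.coeff i).den_ne_zero, fun x hx ↦ ?_⟩
  rw [eval_eq_sum_range, mul_sum]
  refine R.sum_mem fun i hi ↦ ?_
  rw [← mul_assoc]
  refine R.mul_mem ?_ (R.pow_mem hx i)
  rw [← prod_erase_mul _ _ hi]
  push_cast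
  rw [mul_assoc, mul_comm ((G.coeff i).den : ℚ), Rat.mul_den_eq_num]
  exact R.mul_mem (R.prod_mem fun _ _ ↦ natCast_mem R _) (intCast_mem R _)

/-- A form of Runge's theorem: if `F` is not a square, then `y ^ 2 = F(x)` has only finitely many
`S`-integral solutions for which `y` is close to the same branch of the square root of `F`
at all places of `S` where `x` is large. -/
theorem runge_sq_eq {V : Finset (AbsoluteValue ℚ ℝ)} {R : Subring ℚ}
    (hprod : ∀ x ∈ R, x ≠ 0 → 1 ≤ ∏ v ∈ V, v x)
    (hfin : ∀ c : ℝ, {x | x ∈ R ∧ ∀ v ∈ V, v x ≤ c}.Finite)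
    {F : ℚ[X]} {a : ℚ} {D : ℕ} (hD : 0 < D) (ha : a ≠ 0) (hF : F.natDegree ≤ 2 * D)
    (hlc : F.coeff (2 * D) = a ^ 2) (hsq : ¬ IsSquare F) :
    ∃ L₀ : ℝ, ∀ L, L₀ ≤ L → ∃ E : Set ℚ, E.Finite ∧ ∀ x ∈ R, x ∉ E → ∀ y ∈ R, y ^ 2 = F.eval x →
      ¬ ∀ v ∈ V, L ≤ v x → v (y - a * x ^ D) ≤ v 2 / 2 * v (a * x ^ D) := by
  obtain ⟨G, hG, hFG⟩ := exists_sub_sq_coeff_eq_zero ha hF hlc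
  choose L₁ hL₁ using fun v ↦ exists_abv_sub_mul_max_le v hD ha hG hFG
  obtain ⟨L₀, hL₀⟩ := (V.finite_toSet.image L₁).bddAbove
  refine ⟨L₀, fun L hL ↦ ?_⟩
  have hLv : ∀ v ∈ V, L₁ v ≤ L := fun v hv ↦ (hL₀ ⟨v, hv, rfl⟩).trans hL
  choose! c hc using fun v hv ↦ hL₁ v L (hLv v hv)
  obtain ⟨N, hN, hNG⟩ := exists_nat_mul_eval_mem R G
  have hN' : (N : ℚ) ≠ 0 := by exact_mod_cast hN
  obtain ⟨M, hM⟩ := (V.finite_toSet.image fun v ↦ v N * c v).bddAbove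
  have hne : F - G ^ 2 ≠ 0 := fun h ↦ hsq ⟨G, by rw [← sq, ← sub_eq_zero, h]⟩
  refine ⟨{x | x ∈ R ∧ ∀ v ∈ V, v x ≤ max 1 M ^ #V} ∪ {x | (F - G ^ 2).IsRoot x},
    (hfin _).union (finite_setOfPred_isRoot hne), fun x hx hxE y hy hyF hclose ↦ hxE ?_⟩
  by_cases hT : y - G.eval x = 0
  · right
    rw [Set.mem_ofPred_eq, IsRoot.def, eval_sub, eval_pow, ← hyF, sub_eq_zero.mp hT, sub_self]
  left
  refine ⟨hx, fun w hw ↦ ?_⟩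
  have hNT : (N : ℚ) * (y - G.eval x) ∈ R := by
    rw [mul_sub]
    exact R.sub_mem (R.mul_mem (natCast_mem R N) hy) (hNG x hx)
  have h1 := hprod _ hNT (mul_ne_zero hN' hT)
  have h2 : ∀ v ∈ V, v (N * (y - G.eval x)) * max 1 (v x) ≤ max 1 M := by
    intro v hv
    refine le_trans ?_ ((hM ⟨v, hv, rfl⟩).trans (le_max_right _ _))
    rw [map_mul, mul_assoc]
    exact mul_le_mul_of_nonneg_left (hc v hv x y hyF (hclose v hv)) (v.nonneg _)
  have hmax : ∀ v : AbsoluteValue ℚ ℝ, 1 ≤ max 1 (v x) := fun v ↦ le_max_left _ _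
  calc w x ≤ ∏ v ∈ V, max (v x) 1 := le_prod_max_one hw fun v : AbsoluteValue ℚ ℝ ↦ v x
    _ = ∏ v ∈ V, max 1 (v x) := by simp only [max_comm]
    _ ≤ (∏ v ∈ V, v (N * (y - G.eval x))) * ∏ v ∈ V, max 1 (v x) :=
        le_mul_of_one_le_left (prod_nonneg fun v _ ↦ zero_le_one.trans (hmax v)) h1
    _ = ∏ v ∈ V, v (N * (y - G.eval x)) * max 1 (v x) := prod_mul_distrib.symm
    _ ≤ ∏ v ∈ V, max 1 M := prod_le_prod
        (fun v _ ↦ mul_nonneg (v.nonneg _) (zero_le_one.trans (hmax v))) h2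
    _ = _ := prod_const _

end Runge

section Places

open Finset

/-- The subring of rational numbers whose denominators are divisible only by primes dividing `b`. -/
def Rat.subringAwayFrom (b : ℕ) : Subring ℚ where
  carrier := {x | ∀ p : ℕ, p.Prime → p ∣ x.den → p ∣ b}
  mul_mem' {x y} hx hy p hp h := by
    rcases (hp.dvd_mul).mp (h.trans (Rat.mul_den_dvd x y)) with h | h
    exacts [hx p hp h, hy p hp h]
  add_mem' {x y} hx hy p hp h := by
    rcases (hp.dvd_mul).mp (h.trans (Rat.add_den_dvd x y)) with h | h
    exacts [hx p hp h, hy p hp h]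
  one_mem' p hp h := by simp [hp.ne_one] at h
  zero_mem' p hp h := by simp [hp.ne_one] at h
  neg_mem' {x} hx p hp h := hx p hp (by simpa using h)

lemma Rat.mem_subringAwayFrom {b : ℕ} {x : ℚ} :
    x ∈ Rat.subringAwayFrom b ↔ ∀ p : ℕ, p.Prime → p ∣ x.den → p ∣ b := Iff.rfl

/-- The `p`-adic absolute value on `ℚ` if `p` is prime, and the usual one otherwise. -/
noncomputable def Rat.placeOfNat (p : ℕ) : AbsoluteValue ℚ ℝ :=
  if h : p.Prime then have : Fact p.Prime := ⟨h⟩; Rat.AbsoluteValue.padic p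
  else Rat.AbsoluteValue.real

lemma Rat.placeOfNat_one (x : ℚ) : Rat.placeOfNat 1 x = |(x : ℝ)| := by
  simp [Rat.placeOfNat, Nat.not_prime_one, Rat.AbsoluteValue.real_eq_abs]

lemma Rat.placeOfNat_natCast {p : ℕ} (hp : p.Prime) {k : ℕ} (hk : k ≠ 0) :
    Rat.placeOfNat p k = ((p : ℝ) ^ k.factorization p)⁻¹ := by
  have : Fact p.Prime := ⟨hp⟩
  rw [Rat.placeOfNat, dif_pos hp, Rat.AbsoluteValue.padic_eq_padicNorm,
    padicNorm.eq_zpow_of_nonzero (by exact_mod_cast hk), padicValRat.of_nat,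
    Nat.factorization_def _ hp]
  simp

lemma Rat.placeOfNat_intCast {p : ℕ} (hp : p.Prime) {k : ℤ} (hk : k ≠ 0) :
    Rat.placeOfNat p k = ((p : ℝ) ^ k.natAbs.factorization p)⁻¹ := by
  rw [← Rat.placeOfNat_natCast hp (Int.natAbs_ne_zero.mpr hk)]
  rcases Int.natAbs_eq k with h | h
  · rw [← Int.cast_natCast, ← h]
  · nth_rw 1 [h]
    simp

lemma Nat.prod_pow_factorization_le {k : ℕ} (hk : k ≠ 0) (s : Finset ℕ) :
    ∏ p ∈ s, p ^ k.factorization p ≤ k := by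
  have h1 : ∏ p ∈ s, p ^ k.factorization p = ∏ p ∈ s ∩ k.primeFactors, p ^ k.factorization p := by
    refine (prod_subset inter_subset_left fun p hp hps ↦ ?_).symm
    rw [Finsupp.notMem_support_iff.mp, pow_zero]
    exact fun h ↦ hps (mem_inter.mpr ⟨hp, h⟩)
  rw [h1]
  conv_rhs => rw [← Nat.prod_factorization_pow_eq_self hk]
  refine prod_le_prod_of_subset_of_one_le' inter_subset_right fun p hp _ ↦ ?_
  exact Nat.pow_pos (Nat.prime_of_mem_primeFactors hp).pos

lemma Nat.prod_pow_factorization_eq {k b : ℕ} (hk : k ≠ 0) (hb : b ≠ 0)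
    (h : ∀ p : ℕ, p.Prime → p ∣ k → p ∣ b) :
    ∏ p ∈ b.primeFactors, p ^ k.factorization p = k := by
  conv_rhs => rw [← Nat.prod_factorization_pow_eq_self hk]
  refine (prod_subset (fun p hp ↦ ?_) fun p _ hp ↦ ?_).symm
  · have hp : p ∈ k.primeFactors := hp
    rw [Nat.mem_primeFactors] at hp ⊢
    exact ⟨hp.1, h p hp.1 hp.2.1, hb⟩
  · rw [Finsupp.notMem_support_iff.mp hp, pow_zero]

open Classical in
/-- The archimedean absolute value on `ℚ` together with the `p`-adic ones for `p ∣ b`. -/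
noncomputable def Rat.placesOver (b : ℕ) : Finset (AbsoluteValue ℚ ℝ) :=
  (insert 1 b.primeFactors).image Rat.placeOfNat

lemma Rat.prod_placesOver {b : ℕ} (x : ℚ) :
    ∏ v ∈ Rat.placesOver b, v x = |(x : ℝ)| * ∏ p ∈ b.primeFactors, Rat.placeOfNat p x := by
  classical
  have hlt : ∀ p : ℕ, p.Prime → Rat.placeOfNat p p < 1 := by
    intro p hp
    rw [Rat.placeOfNat_natCast hp hp.ne_zero, hp.factorization_self, pow_one]
    exact inv_lt_one_of_one_lt₀ (by exact_mod_cast hp.one_lt)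
  have hge : ∀ p q : ℕ, p.Prime → p ≠ q → (q = 1 ∨ q.Prime) → 1 ≤ Rat.placeOfNat q p := by
    rintro p q hp hpq (rfl | hq)
    · rw [Rat.placeOfNat_one]
      simpa using hp.one_lt.le
    · rw [Rat.placeOfNat_natCast hq hp.ne_zero, Nat.factorization_eq_zero_of_not_dvd]
      · simp
      · exact fun h ↦ hpq ((Nat.prime_dvd_prime_iff_eq hq hp).mp h).symm
  have hprime : ∀ p ∈ insert 1 b.primeFactors, p = 1 ∨ p.Prime := by
    intro p hp
    rcases mem_insert.mp hp with rfl | hp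
    exacts [Or.inl rfl, Or.inr (Nat.prime_of_mem_primeFactors hp)]
  have hinj : Set.InjOn Rat.placeOfNat (insert 1 b.primeFactors : Finset ℕ) := by
    intro p hp q hq h
    by_contra hpq
    rcases hprime p hp with rfl | hp'
    · rcases hprime q hq with rfl | hq'
      · exact hpq rfl
      · have h1 := hlt q hq'
        rw [← h] at h1
        exact (hge q 1 hq' (Ne.symm hpq) (Or.inl rfl)).not_gt h1
    · have h1 := hlt p hp'
      rw [h] at h1
      exact (hge p q hp' hpq (hprime q hq)).not_gt h1
  rw [Rat.placesOver, prod_image hinj, prod_insert, Rat.placeOfNat_one]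
  exact fun h ↦ Nat.not_prime_one (Nat.prime_of_mem_primeFactors h)

lemma Rat.one_le_prod_placesOver {b : ℕ} (hb : b ≠ 0) {x : ℚ} (hx : x ∈ Rat.subringAwayFrom b)
    (hx0 : x ≠ 0) : 1 ≤ ∏ v ∈ Rat.placesOver b, v x := by
  have hn : x.num.natAbs ≠ 0 := Int.natAbs_ne_zero.mpr (Rat.num_ne_zero.mpr hx0)
  have hden : ∏ p ∈ b.primeFactors, (p : ℝ) ^ x.den.factorization p = x.den := by
    exact_mod_cast Nat.prod_pow_factorization_eq x.den_ne_zero hb (Rat.mem_subringAwayFrom.mp hx)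
  have hnum : ∏ p ∈ b.primeFactors, (p : ℝ) ^ x.num.natAbs.factorization p ≤ x.num.natAbs := by
    exact_mod_cast Nat.prod_pow_factorization_le hn b.primeFactors
  have hpos : 0 < ∏ p ∈ b.primeFactors, (p : ℝ) ^ x.num.natAbs.factorization p :=
    prod_pos fun p hp ↦ pow_pos (by exact_mod_cast (Nat.prime_of_mem_primeFactors hp).pos) _
  have hdpos : (0 : ℝ) < x.den := by exact_mod_cast x.den_pos
  have h1 : ∀ p ∈ b.primeFactors, Rat.placeOfNat p x =
      (p : ℝ) ^ x.den.factorization p / (p : ℝ) ^ x.num.natAbs.factorization p := by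
    intro p hp
    have hp' := Nat.prime_of_mem_primeFactors hp
    conv_lhs => rw [← Rat.num_div_den x]
    rw [map_div₀, Rat.placeOfNat_intCast hp' (Rat.num_ne_zero.mpr hx0),
      Rat.placeOfNat_natCast hp' x.den_ne_zero, div_inv_eq_mul, div_eq_mul_inv, mul_comm]
  have h2 : |(x : ℝ)| = (x.num.natAbs : ℝ) / x.den := by
    conv_lhs => rw [← Rat.num_div_den x]
    push_cast
    rw [abs_div, Nat.abs_cast, Nat.cast_natAbs, Int.cast_abs]
  rw [Rat.prod_placesOver, prod_congr rfl h1, prod_div_distrib, hden, h2,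
    div_mul_div_cancel₀ hdpos.ne', one_le_div hpos]
  exact hnum

lemma Rat.finite_setOf_placesOver_le {b : ℕ} (hb : b ≠ 0) (c : ℝ) :
    {x | x ∈ Rat.subringAwayFrom b ∧ ∀ v ∈ Rat.placesOver b, v x ≤ c}.Finite := by
  classical
  set K := max 1 c ^ #b.primeFactors
  have hK : 1 ≤ K := one_le_pow₀ (le_max_left _ _)
  refine Set.Finite.subset (s := (fun y : ℤ × ℕ ↦ (y.1 : ℚ) / y.2) ''
    (Set.Icc (-⌈max 1 c * K⌉) ⌈max 1 c * K⌉ ×ˢ Set.Iic ⌈K⌉₊))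
    (((Set.finite_Icc _ _).prod (Set.finite_Iic _)).image _) ?_
  rintro x ⟨hx, hv⟩
  rw [Rat.mem_subringAwayFrom] at hx
  have hden : (x.den : ℝ) ≤ K := by
    rw [← Nat.prod_pow_factorization_eq x.den_ne_zero hb hx]
    push_cast
    rw [show K = ∏ _p ∈ b.primeFactors, max 1 c from (prod_const _).symm]
    refine prod_le_prod (fun _ _ ↦ by positivity) fun p hp ↦ ?_
    have hp' := Nat.prime_of_mem_primeFactors hp
    by_cases hpd : p ∣ x.den
    · refine le_trans ?_ (le_max_right _ _)
      have hpn : x.num.natAbs.factorization p = 0 := by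
        refine Nat.factorization_eq_zero_of_not_dvd fun h ↦ hp'.ne_one ?_
        exact Nat.eq_one_of_dvd_coprimes x.reduced h hpd
      have hn : x.num ≠ 0 := by
        intro h
        have := x.reduced
        rw [h, Int.natAbs_zero, Nat.coprime_zero_left] at this
        rw [this] at hpd
        exact hp'.one_lt.ne' (Nat.dvd_one.mp hpd)
      have h1 := hv (Rat.placeOfNat p)
        (mem_image_of_mem _ (mem_insert_of_mem hp))
      rw [← Rat.num_div_den x, map_div₀, Rat.placeOfNat_intCast hp' hn,
        Rat.placeOfNat_natCast hp' x.den_ne_zero, hpn, pow_zero, inv_one, one_div, inv_inv] at h1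
      exact h1
    · rw [Nat.factorization_eq_zero_of_not_dvd hpd, pow_zero]
      exact le_max_left _ _
  have habs : |(x.num : ℝ)| ≤ max 1 c * K := by
    have h1 := hv (Rat.placeOfNat 1) (mem_image_of_mem _ (mem_insert_self _ _))
    have hdpos : (0 : ℝ) < x.den := by exact_mod_cast x.den_pos
    rw [Rat.placeOfNat_one, ← Rat.num_div_den x] at h1
    push_cast at h1
    rw [abs_div, Nat.abs_cast, div_le_iff₀ hdpos] at h1
    refine h1.trans (mul_le_mul (le_max_right _ _) hden hdpos.le ?_)
    exact zero_le_one.trans (le_max_left _ _)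
  rw [abs_le] at habs
  refine ⟨(x.num, x.den), ⟨⟨?_, ?_⟩, ?_⟩, Rat.num_div_den x⟩
  · have : (-⌈max 1 c * K⌉ : ℝ) ≤ x.num := by linarith [Int.le_ceil (max 1 c * K)]
    exact_mod_cast this
  · exact_mod_cast habs.2.trans (Int.le_ceil _)
  · exact_mod_cast hden.trans (Nat.le_ceil _)

end Places

section SquareClasses

open Finset

lemma AbsoluteValue.sub_one_le_of_sq {K : Type*} [Field K] (v : AbsoluteValue K ℝ) {u : K} {δ : ℝ}
    (hδ : 0 ≤ δ) (h : v (u ^ 2 - 1) ≤ δ ^ 2) (hle : v (u - 1) ≤ v (u + 1)) : v (u - 1) ≤ δ := by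
  rw [← sq_le_sq₀ (v.nonneg _) hδ]
  refine le_trans ?_ h
  rw [show u ^ 2 - 1 = (u - 1) * (u + 1) by ring, map_mul, sq]
  exact mul_le_mul_of_nonneg_left hle (v.nonneg _)

lemma AbsoluteValue.sub_one_le_of_sub_one_le {K : Type*} [Field K] (v : AbsoluteValue K ℝ)
    {u u₁ u₂ θ : K} {δ : ℝ} (hδ0 : 0 ≤ δ) (hδ : δ ≤ 1 / 8) (hu : u₁ * u₂ = u * (1 + θ))
    (hθ : v θ ≤ δ ^ 2 / 3) (h₁ : v (u₁ - 1) ≤ δ) (h₂ : v (u₂ - 1) ≤ δ) : v (u - 1) ≤ 8 * δ := by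
  have h3 : (u - 1) * (1 + θ) = (u₁ - 1) * (u₂ - 1) + ((u₁ - 1) + (u₂ - 1)) - θ := by
    linear_combination -hu
  have h4 : v ((u - 1) * (1 + θ)) ≤ δ * δ + (δ + δ) + δ ^ 2 / 3 := by
    rw [h3]
    refine (v.sub_le_add _ _).trans (add_le_add ((v.add_le _ _).trans (add_le_add ?_ ?_)) hθ)
    · rw [map_mul]
      exact mul_le_mul h₁ h₂ (v.nonneg _) hδ0
    · exact (v.add_le _ _).trans (add_le_add h₁ h₂)
  have h5 : 1 ≤ v (1 + θ) + v θ := by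
    calc (1 : ℝ) = v ((1 + θ) - θ) := by simp
      _ ≤ _ := v.sub_le_add _ _
  rw [map_mul] at h4
  have h6 : 1 / 2 ≤ v (1 + θ) := by nlinarith
  nlinarith [v.nonneg (u - 1)]

lemma AbsoluteValue.sub_one_le_of_same_sign {K : Type*} [Field K] (v : AbsoluteValue K ℝ)
    {u u₁ u₂ θ θ₁ θ₂ : K} {δ : ℝ} (hδ0 : 0 ≤ δ) (hδ : δ ≤ 1 / 8)
    (hu : u₁ * u₂ = u * (1 + θ)) (hu₁ : u₁ ^ 2 = (1 + θ₁) * (1 + θ))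
    (hu₂ : u₂ ^ 2 = (1 + θ₂) * (1 + θ)) (hθ : v θ ≤ δ ^ 2 / 3) (hθ₁ : v θ₁ ≤ δ ^ 2 / 3)
    (hθ₂ : v θ₂ ≤ δ ^ 2 / 3) (hsign : v (u₁ - 1) ≤ v (u₁ + 1) ↔ v (u₂ - 1) ≤ v (u₂ + 1)) :
    v (u - 1) ≤ 8 * δ := by
  have hsq : ∀ w ρ : K, w ^ 2 = (1 + ρ) * (1 + θ) → v ρ ≤ δ ^ 2 / 3 → v (w ^ 2 - 1) ≤ δ ^ 2 := by
    intro w ρ hw hρ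
    rw [hw, show (1 + ρ) * (1 + θ) - 1 = ρ * θ + (ρ + θ) by ring]
    have h1 := v.add_le (ρ * θ) (ρ + θ)
    have h2 := v.add_le ρ θ
    rw [map_mul] at h1
    have h3 : v ρ * v θ ≤ δ ^ 2 / 3 * (δ ^ 2 / 3) :=
      mul_le_mul hρ hθ (v.nonneg _) (by positivity)
    have h4 : δ ^ 2 ≤ 1 := pow_le_one₀ hδ0 (by linarith)
    have h5 : δ ^ 2 * δ ^ 2 ≤ δ ^ 2 * 1 := mul_le_mul_of_nonneg_left h4 (sq_nonneg _)
    linarith [sq_nonneg δ]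
  have h1 := hsq u₁ θ₁ hu₁ hθ₁
  have h2 := hsq u₂ θ₂ hu₂ hθ₂
  by_cases hs : v (u₁ - 1) ≤ v (u₁ + 1)
  · exact v.sub_one_le_of_sub_one_le hδ0 hδ hu hθ (v.sub_one_le_of_sq hδ0 h1 hs)
      (v.sub_one_le_of_sq hδ0 h2 (hsign.mp hs))
  · have hneg : ∀ w : K, ¬ v (w - 1) ≤ v (w + 1) → v (-w - 1) ≤ v (-w + 1) := by
      intro w hw
      rw [show -w - 1 = -(w + 1) by ring, show -w + 1 = -(w - 1) by ring, v.map_neg, v.map_neg]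
      exact (not_le.mp hw).le
    refine v.sub_one_le_of_sub_one_le (u₁ := -u₁) (u₂ := -u₂) hδ0 hδ (by rw [← hu]; ring) hθ
      (v.sub_one_le_of_sq hδ0 (by rwa [neg_sq]) (hneg _ hs))
      (v.sub_one_le_of_sq hδ0 (by rwa [neg_sq]) (hneg _ fun h ↦ hs (hsign.mpr h)))

lemma exists_abv_eval_div_sub_one_le (v : AbsoluteValue ℚ ℝ) {g : ℚ[X]} (hg : 0 < g.natDegree)
    {η : ℝ} (hη : 0 < η) :
    ∃ L : ℝ, ∀ x, L ≤ v x → v (g.eval x / (g.leadingCoeff * x ^ g.natDegree) - 1) ≤ η := by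
  have hlc : g.leadingCoeff ≠ 0 := leadingCoeff_ne_zero.mpr (ne_zero_of_natDegree_gt hg)
  have hva : 0 < v g.leadingCoeff := v.pos hlc
  obtain ⟨c, hc, h⟩ := exists_abv_eval_le_of_coeff_eq_zero v
    (F := g - C g.leadingCoeff * X ^ g.natDegree) hg (fun m hm ↦ by
      rw [coeff_sub, coeff_C_mul, coeff_X_pow]
      rcases hm.eq_or_lt with rfl | hm
      · simp
      · rw [coeff_eq_zero_of_natDegree_lt hm, if_neg (by omega)]; simp)
  refine ⟨max 1 (c / (v g.leadingCoeff * η)), fun x hx ↦ ?_⟩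
  rw [max_le_iff, div_le_iff₀ (by positivity)] at hx
  have hx0 : x ≠ 0 := by
    rintro rfl
    rw [map_zero] at hx
    linarith [hx.1]
  have h1 := h x hx.1
  simp only [eval_sub, eval_mul, eval_C, eval_pow, eval_X] at h1
  have hp : 0 < v x ^ g.natDegree := pow_pos (by linarith [hx.1]) _
  rw [div_sub_one (mul_ne_zero hlc (pow_ne_zero _ hx0)), map_div₀, map_mul, map_pow,
    div_le_iff₀ (by positivity)]
  have h2 : c * v x ^ g.natDegree ≤ η * (v g.leadingCoeff * v x ^ g.natDegree) * v x := by
    nlinarith [hx.2]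
  exact le_of_mul_le_mul_right (h1.trans h2) (by linarith [hx.1])

/-- Among sufficiently many polynomials whose pairwise products are not squares, at least one takes
a value outside a given finite set of square classes, for all but finitely many `S`-integral
arguments. -/
theorem exists_finite_forall_exists_eval_ne {V : Finset (AbsoluteValue ℚ ℝ)} {R : Subring ℚ}
    (hprod : ∀ x ∈ R, x ≠ 0 → 1 ≤ ∏ v ∈ V, v x)
    (hfin : ∀ c : ℝ, {x | x ∈ R ∧ ∀ v ∈ V, v x ≤ c}.Finite)
    {S : Finset ℚ} (hS : ∀ s ∈ S, s ∈ R) {ι : Type*} {I : Finset ι} {g : ι → ℚ[X]} {ε : ℕ} {l : ℚ}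
    (hl : l ≠ 0) {a : ι → ℚ} {m : ι → ℕ} (ha : ∀ i ∈ I, a i ≠ 0) (hm : ∀ i ∈ I, 0 < m i)
    (hdeg : ∀ i ∈ I, (g i).natDegree = 2 * m i + ε)
    (hlc : ∀ i ∈ I, (g i).leadingCoeff = l * a i ^ 2)
    (hsq : ∀ i ∈ I, ∀ j ∈ I, i ≠ j → ¬ IsSquare (g i * g j)) (hcard : #S * 2 ^ #V < #I) :
    ∃ E : Set ℚ, E.Finite ∧ ∀ x ∈ R, x ∉ E → ∃ i ∈ I, ∀ s ∈ S, ∀ c ∈ R,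
      (g i).eval x ≠ s * c ^ 2 := by
  classical
  have hne : Nonempty ι := ⟨(card_pos.mp (by omega : 0 < #I)).choose⟩
  have hv2 : ∀ v : AbsoluteValue ℚ ℝ, 0 < v 2 ∧ v 2 ≤ 2 := by
    refine fun v ↦ ⟨v.pos two_ne_zero, ?_⟩
    have := v.add_le 1 1
    rw [map_one] at this
    norm_num at this ⊢
    exact this
  have hθ := fun (v : AbsoluteValue ℚ ℝ) (i : ι) (hi : i ∈ I) ↦
    exists_abv_eval_div_sub_one_le v (g := g i) (by have := hm i hi; have := hdeg i hi; omega)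
      (η := (v 2 / 16) ^ 2 / 3) (by have := (hv2 v).1; positivity)
  choose! L₁ hL₁ using hθ
  have hR := fun (i : ι) (hi : i ∈ I) (j : ι) (hj : j ∈ I) (hij : i ≠ j) ↦
    runge_sq_eq hprod hfin (F := g i * g j) (a := l * a i * a j) (D := m i + m j + ε)
      (by have := hm i hi; omega) (mul_ne_zero (mul_ne_zero hl (ha i hi)) (ha j hj))
      (by have := natDegree_mul_le (p := g i) (q := g j)
          rw [hdeg i hi, hdeg j hj] at this
          omega)
      (by have h := coeff_mul_degree_add_degree (g i) (g j)
          rw [hdeg i hi, hdeg j hj, hlc i hi, hlc j hj] at h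
          rw [show 2 * (m i + m j + ε) = 2 * m i + ε + (2 * m j + ε) by ring, h]
          ring)
      (hsq i hi j hj hij)
  choose! L₂ hL₂ using hR
  obtain ⟨M₁, hM₁⟩ := ((V ×ˢ I).finite_toSet.image fun z ↦ L₁ z.1 z.2).bddAbove
  obtain ⟨M₂, hM₂⟩ := ((I ×ˢ I).finite_toSet.image fun z ↦ L₂ z.1 z.2).bddAbove
  set L := max 1 (max M₁ M₂)
  have hLL₁ : ∀ v ∈ V, ∀ i ∈ I, L₁ v i ≤ L := fun v hv i hi ↦
    (hM₁ ⟨(v, i), mem_product.mpr ⟨hv, hi⟩, rfl⟩).trans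
      ((le_max_left _ _).trans (le_max_right _ _))
  have hLL₂ : ∀ i ∈ I, ∀ j ∈ I, L₂ i j ≤ L := fun i hi j hj ↦
    (hM₂ ⟨(i, j), mem_product.mpr ⟨hi, hj⟩, rfl⟩).trans
      ((le_max_right _ _).trans (le_max_right _ _))
  have hE := fun i hi j hj hij ↦ hL₂ i hi j hj hij L (hLL₂ i hi j hj)
  choose! E hEfin hE using hE
  have hU : (⋃ z ∈ (I.offDiag : Set (ι × ι)), E z.1 z.2).Finite := by
    refine (finite_toSet I.offDiag).biUnion fun z hz ↦ ?_
    rw [mem_coe, mem_offDiag] at hz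
    exact hEfin z.1 hz.1 z.2 hz.2.1 hz.2.2
  refine ⟨_, hU.insert 0, fun x hx hxE ↦ ?_⟩
  have hx0 : x ≠ 0 := fun h ↦ hxE (Or.inl h)
  have hxE' : ∀ i ∈ I, ∀ j ∈ I, i ≠ j → x ∉ E i j := fun i hi j hj hij h ↦
    hxE (Or.inr (Set.mem_biUnion (x := (i, j)) (by simp [hi, hj, hij]) h))
  by_contra! hcon
  choose! s hs c hc hg using hcon
  set τ := l * x ^ ε
  set t : ι → ℚ := fun i ↦ a i * x ^ m i
  have hτ : τ ≠ 0 := mul_ne_zero hl (pow_ne_zero _ hx0)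
  have ht : ∀ i ∈ I, t i ≠ 0 := fun i hi ↦ mul_ne_zero (ha i hi) (pow_ne_zero _ hx0)
  set θ : ι → ℚ := fun i ↦ (g i).eval x / (τ * t i ^ 2) - 1 with hθdef
  have hθ : ∀ v ∈ V, L ≤ v x → ∀ i ∈ I, v (θ i) ≤ (v 2 / 16) ^ 2 / 3 := by
    intro v hv hvx i hi
    have := hL₁ v i hi x ((hLL₁ v hv i hi).trans hvx)
    rw [hlc i hi, hdeg i hi] at this
    convert this using 4
    simp only [τ, t]
    ring
  set u : ι → ι → ℚ := fun i j ↦ s i * c i * c j / (τ * t i * t j) with hu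
  have hθs : ∀ i ∈ I, s i * c i ^ 2 = τ * t i ^ 2 * (1 + θ i) := by
    intro i hi
    have := ht i hi
    rw [← hg i hi, hθdef]
    field_simp
    ring
  have husq : ∀ i ∈ I, ∀ j ∈ I, s i = s j → u i j ^ 2 = (1 + θ i) * (1 + θ j) := by
    intro i hi j hj hij
    have h1 := ht i hi
    have h2 := ht j hj
    have h3 := hθs i hi
    have h4 := hθs j hj
    have h5 : (s i * c i * c j) ^ 2 = (s i * c i ^ 2) * (s j * c j ^ 2) := by rw [← hij]; ring
    rw [hu]
    simp only
    rw [div_pow, h5, h3, h4]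
    field_simp
  have humul : ∀ i ∈ I, ∀ j ∈ I, ∀ r ∈ I, s i = s r → s j = s r →
      u i r * u j r = u i j * (1 + θ r) := by
    intro i hi j hj r hr hir hjr
    have h1 := ht i hi
    have h2 := ht j hj
    have h4 := ht r hr
    have h3 := hθs r hr
    have h5 : (s i * c i * c r) * (s j * c j * c r) = (s i * c i * c j) * (s r * c r ^ 2) := by
      rw [hjr]; ring
    rw [hu]
    simp only
    rw [div_mul_div_comm, h5, h3]
    field_simp
  set r : ι → ι := fun i ↦ Function.invFunOn s (I : Set ι) (s i)
  have hrI : ∀ i ∈ I, r i ∈ I := fun i hi ↦ Function.invFunOn_mem ⟨i, hi, rfl⟩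
  have hrs : ∀ i ∈ I, s i = s (r i) := fun i hi ↦ (Function.invFunOn_eq ⟨i, hi, rfl⟩).symm
  obtain ⟨i, hi, j, hj, hij, hcol⟩ := exists_ne_map_eq_of_card_lt_of_maps_to
    (s := I) (t := S ×ˢ V.powerset)
    (f := fun i ↦ (s i, V.filter fun v ↦ v (u i (r i) - 1) ≤ v (u i (r i) + 1)))
    (by rwa [card_product, card_powerset])
    (fun i hi ↦ by
      rw [mem_coe] at hi
      simp only [coe_product, Set.mem_prod, mem_coe, mem_powerset]
      exact ⟨hs i hi, filter_subset _ _⟩)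
  simp only [Prod.mk.injEq] at hcol
  obtain ⟨hsij, hcol⟩ := hcol
  have hrij : r i = r j := by simp only [r, hsij]
  refine hE i hi j hj hij x hx (hxE' i hi j hj hij) (s i * c i * c j)
    (R.mul_mem (R.mul_mem (hS _ (hs i hi)) (hc i hi)) (hc j hj)) ?_ fun v hv hvx ↦ ?_
  · rw [eval_mul, hg i hi, hg j hj, ← hsij]; ring
  · have hsign : v (u i (r i) - 1) ≤ v (u i (r i) + 1) ↔ v (u j (r i) - 1) ≤ v (u j (r i) + 1) := by
      have := Finset.ext_iff.mp hcol v
      simpa [hv, hrij] using this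
    have hj' : s j = s (r i) := by rw [hrij]; exact hrs j hj
    have hri := hrI i hi
    have key := v.sub_one_le_of_same_sign (δ := v 2 / 16) (by linarith [(hv2 v).1])
      (by linarith [(hv2 v).2]) (humul i hi j hj _ hri (hrs i hi) hj') (husq i hi _ hri (hrs i hi))
      (husq j hj _ hri hj') (hθ v hv hvx _ hri) (hθ v hv hvx i hi) (hθ v hv hvx j hj) hsign
    have h1 := ht i hi
    have h2 := ht j hj
    have h3 : s i * c i * c j - l * a i * a j * x ^ (m i + m j + ε) =
        (u i j - 1) * (l * a i * a j * x ^ (m i + m j + ε)) := by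
      have h4 : l * a i * a j * x ^ (m i + m j + ε) = τ * t i * t j := by
        simp only [τ, t]; ring
      rw [h4, hu]
      simp only
      field_simp
    rw [h3, map_mul]
    refine mul_le_mul_of_nonneg_right (key.trans_eq (by ring)) (v.nonneg _)

end SquareClasses

section OrbitNumerators

/-- The homogenization of `f` with respect to its degree, evaluated at `(x, y)`. -/
def homogEval (f : ℤ[X]) (x y : ℤ) : ℤ :=
  ∑ i ∈ Finset.range (f.natDegree + 1), f.coeff i * x ^ i * y ^ (f.natDegree - i)

lemma intCast_homogEval {K : Type*} [Field K] (f : ℤ[X]) (x : ℤ) {y : ℤ} (hy : (y : K) ≠ 0) :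
    (homogEval f x y : K) = (y : K) ^ f.natDegree * aeval ((x : K) / y) f := by
  rw [homogEval, aeval_eq_sum_range, Finset.mul_sum]
  push_cast
  refine Finset.sum_congr rfl fun i hi ↦ ?_
  have hi' : i + (f.natDegree - i) = f.natDegree := by
    have := Finset.mem_range.mp hi
    omega
  rw [zsmul_eq_mul, div_pow]
  nth_rw 2 [← hi']
  rw [pow_add]
  field_simp

lemma abs_homogEval_le (f : ℤ[X]) {x y M : ℤ} (hx : |x| ≤ M) (hy : |y| ≤ M) :
    |homogEval f x y| ≤
      (∑ i ∈ Finset.range (f.natDegree + 1), |f.coeff i|) * M ^ f.natDegree := by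
  rw [homogEval, Finset.sum_mul]
  refine (Finset.abs_sum_le_sum_abs _ _).trans (Finset.sum_le_sum fun i hi ↦ ?_)
  have hi' : i + (f.natDegree - i) = f.natDegree := by
    have := Finset.mem_range.mp hi
    omega
  rw [abs_mul, abs_mul, abs_pow, abs_pow, mul_assoc, ← hi', pow_add, hi']
  have hM : 0 ≤ M := (abs_nonneg x).trans hx
  gcongr

/-- The numerator of `f^(n)(a / b)` over the denominator `b ^ (d ^ n)`, where `d = deg f`. -/
def orbitNum (f : ℤ[X]) (a b : ℤ) : ℕ → ℤ
  | 0 => a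
  | n + 1 => homogEval f (orbitNum f a b n) (b ^ f.natDegree ^ n)

lemma intCast_orbitNum {K : Type*} [Field K] (f : ℤ[X]) (a : ℤ) {b : ℤ} (hb : (b : K) ≠ 0)
    (n : ℕ) :
    (orbitNum f a b n : K) = (b : K) ^ f.natDegree ^ n * aeval ((a : K) / b) (polyIter f n) := by
  induction n with
  | zero => simp [orbitNum, polyIter, mul_div_cancel₀ (a : K) hb]
  | succ n ih =>
    have hb' : ((b ^ f.natDegree ^ n : ℤ) : K) ≠ 0 := by
      push_cast
      exact pow_ne_zero _ hb
    rw [orbitNum, intCast_homogEval f _ hb', ih, polyIter, aeval_comp]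
    push_cast
    rw [mul_div_cancel_left₀ _ (pow_ne_zero _ hb), ← pow_mul, pow_succ]

lemma exists_abs_orbitNum_le (f : ℤ[X]) (hf : 2 ≤ f.natDegree) (a b : ℤ) :
    ∃ A : ℕ, 2 ≤ A ∧ ∀ n, |orbitNum f a b n| ≤ (A : ℤ) ^ f.natDegree ^ n := by
  set c : ℤ := ∑ i ∈ Finset.range (f.natDegree + 1), |f.coeff i| + 1 with hc
  have hc1 : 1 ≤ c := by
    have : 0 ≤ ∑ i ∈ Finset.range (f.natDegree + 1), |f.coeff i| :=
      Finset.sum_nonneg fun i _ ↦ abs_nonneg _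
    omega
  set m : ℤ := |a| + |b| + 2
  have hm : |a| ≤ m ∧ |b| ≤ m ∧ 2 ≤ m := by
    have := abs_nonneg a
    have := abs_nonneg b
    refine ⟨?_, ?_, ?_⟩ <;> omega
  have hmc : m ≤ c * m := by nlinarith
  have key : ∀ n, c * |orbitNum f a b n| ≤ (c * m) ^ f.natDegree ^ n := by
    intro n
    induction n with
    | zero => simpa [orbitNum] using mul_le_mul_of_nonneg_left hm.1 (by omega)
    | succ n ih =>
      set T := (c * m) ^ f.natDegree ^ n
      have hb : c * |b ^ f.natDegree ^ n| ≤ T := by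
        rw [abs_pow, show T = c ^ f.natDegree ^ n * m ^ f.natDegree ^ n from mul_pow _ _ _]
        have h1 : c ≤ c ^ f.natDegree ^ n := le_self_pow₀ hc1 (pow_ne_zero _ (by omega))
        have h2 := hm.2.1
        have h3 : 0 ≤ m := by omega
        have h4 : 0 ≤ c := by omega
        gcongr
      set y := b ^ f.natDegree ^ n
      set x := orbitNum f a b n
      have h1 := abs_homogEval_le f (le_max_left |x| |y|) (le_max_right |x| |y|)
      set M := max |x| |y|
      have hM : c * M ≤ T := by
        rcases max_choice |x| |y| with h | h <;> simp only [M, h] <;> assumption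
      have hM0 : 0 ≤ M := (abs_nonneg x).trans (le_max_left _ _)
      have h2 : |homogEval f x y| ≤ c * M ^ f.natDegree := by
        refine h1.trans (mul_le_mul_of_nonneg_right ?_ (by positivity))
        omega
      rw [orbitNum, pow_succ, pow_mul]
      have h3 : c ^ 2 ≤ c ^ f.natDegree := pow_le_pow_right₀ hc1 hf
      calc c * |homogEval f x y| ≤ c * (c * M ^ f.natDegree) :=
            mul_le_mul_of_nonneg_left h2 (by omega)
        _ = c ^ 2 * M ^ f.natDegree := by ring
        _ ≤ c ^ f.natDegree * M ^ f.natDegree :=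
            mul_le_mul_of_nonneg_right h3 (pow_nonneg hM0 _)
        _ = (c * M) ^ f.natDegree := (mul_pow _ _ _).symm
        _ ≤ T ^ f.natDegree := pow_le_pow_left₀ (mul_nonneg (by omega) hM0) hM _
  refine ⟨(c * m).toNat, by omega, fun n ↦ ?_⟩
  rw [Int.toNat_of_nonneg (by omega)]
  exact (le_mul_of_one_le_left (abs_nonneg _) hc1).trans (key n)

end OrbitNumerators

section OddValuations

/-- Some prime not dividing `Z` has odd valuation at `B`. -/
def HasOddValuationAwayFrom (Z B : ℤ) : Prop :=
  ∃ p : ℕ, p.Prime ∧ ¬ (p : ℤ) ∣ Z ∧ Odd (padicValInt p B)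

lemma exists_eq_mul_sq_of_not_hasOddValuationAwayFrom {Z B : ℤ} (hZ : Z ≠ 0)
    (h : ¬ HasOddValuationAwayFrom Z B) : ∃ s c : ℤ, |s| ≤ |Z| ∧ B = s * c ^ 2 := by
  by_cases hB : B = 0
  · exact ⟨0, 0, by simp, by simp [hB]⟩
  obtain ⟨s, c, hsc, hs⟩ := Nat.sq_mul_squarefree B.natAbs
  have hB' : B.natAbs ≠ 0 := Int.natAbs_ne_zero.mpr hB
  have hs0 : s ≠ 0 := by rintro rfl; exact hB' (by rw [← hsc]; simp)
  have hc0 : c ≠ 0 := by rintro rfl; exact hB' (by rw [← hsc]; simp)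
  have hdvd : s ∣ Z.natAbs := by
    rw [← Nat.prod_primeFactors_of_squarefree hs,
      Nat.prod_primeFactors_dvd_iff (Int.natAbs_ne_zero.mpr hZ)]
    intro p hp
    rw [Nat.mem_primeFactors] at hp ⊢
    refine ⟨hp.1, ?_, Int.natAbs_ne_zero.mpr hZ⟩
    by_contra hpZ
    have : Fact p.Prime := ⟨hp.1⟩
    refine h ⟨p, hp.1, fun h' ↦ hpZ (Int.natCast_dvd.mp h'), ?_⟩
    rw [padicValInt, ← hsc, padicValNat.mul (pow_ne_zero _ hc0) hs0, padicValNat.pow,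
      ← Nat.factorization_def s hp.1, Nat.factorization_eq_one_of_squarefree hs hp.1 hp.2.1]
    exact ⟨_, rfl⟩
  have hle : s ≤ Z.natAbs := Nat.le_of_dvd (Int.natAbs_pos.mpr hZ) hdvd
  refine ⟨B.sign * s, c, ?_, ?_⟩
  · rw [abs_mul, Int.abs_sign_of_ne_zero hB, one_mul, Nat.abs_cast, Int.abs_eq_natAbs]
    exact_mod_cast hle
  · rw [mul_assoc, mul_comm (s : ℤ)]
    nth_rw 1 [← Int.sign_mul_natAbs B, ← hsc]
    push_cast
    rfl

lemma exists_odd_padicValInt_orbitNum_mul (f : ℤ[X]) (a : ℤ) {b Z : ℤ} (h2 : 2 ∣ Z) (hb : b ∣ Z)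
    (hZ : ∀ k, 1 ≤ k → eval 0 (polyIter f k) ∣ Z) {n m : ℕ} (hnm : n < m)
    (hn0 : orbitNum f a b n ≠ 0) (hm0 : orbitNum f a b m ≠ 0)
    (hn : HasOddValuationAwayFrom Z (orbitNum f a b n)) :
    ∃ p : ℕ, p.Prime ∧ p ≠ 2 ∧ Odd (padicValInt p (orbitNum f a b n * orbitNum f a b m)) := by
  obtain ⟨p, hp, hpZ, hodd⟩ := hn
  have : Fact p.Prime := ⟨hp⟩
  have hcast : ∀ z : ℤ, z ∣ Z → (z : ZMod p) ≠ 0 := fun z hz h ↦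
    hpZ (((ZMod.intCast_zmod_eq_zero_iff_dvd z p).mp h).trans hz)
  have hbp := hcast b hb
  have hn1 : (orbitNum f a b n : ZMod p) = 0 := by
    rw [ZMod.intCast_zmod_eq_zero_iff_dvd]
    by_contra h
    rw [padicValInt.eq_zero_of_not_dvd h] at hodd
    simp at hodd
  rw [intCast_orbitNum f a hbp, mul_eq_zero, or_iff_right (pow_ne_zero _ hbp), aeval_polyIter]
    at hn1
  have hm1 : ¬ (p : ℤ) ∣ orbitNum f a b m := by
    rw [← ZMod.intCast_zmod_eq_zero_iff_dvd, intCast_orbitNum f a hbp]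
    refine mul_ne_zero (pow_ne_zero _ hbp) ?_
    rw [aeval_polyIter, ← Nat.sub_add_cancel hnm.le, Function.iterate_add_apply, hn1,
      ← aeval_polyIter]
    have h := hcast _ (hZ (m - n) (by omega))
    rwa [← eq_intCast (algebraMap ℤ (ZMod p)), ← aeval_algebraMap_apply_eq_algebraMap_eval,
        map_zero] at h
  refine ⟨p, hp, ?_, ?_⟩
  · rintro rfl
    exact hpZ h2
  · rwa [padicValInt.mul hn0 hm0, padicValInt.eq_zero_of_not_dvd hm1, add_zero]

end OddValuations

section NonSquare

/-- The roots of an iterate are simple when the critical orbit misses zero. -/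
lemma eval_derivative_polyIter_ne_zero {K : Type*} [Field K] {f : K[X]}
    (hcrit : ∀ c, (derivative f).eval c = 0 → ∀ k, 1 ≤ k → eval c (polyIter f k) ≠ 0) {n : ℕ}
    {β : K} (hβ : eval β (polyIter f n) = 0) : ∀ k ≤ n, (derivative (polyIter f k)).eval β ≠ 0 := by
  intro k hk
  induction k with
  | zero => simp [polyIter]
  | succ k ih =>
    rw [polyIter, derivative_comp, eval_mul, eval_comp]
    refine mul_ne_zero (ih (by omega)) fun h ↦ hcrit _ h (n - k) (by omega) ?_
    rw [eval_polyIter, eval_polyIter, ← Function.iterate_add_apply, ← eval_polyIter,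
      Nat.sub_add_cancel (by omega), hβ]

lemma not_isSquare_polyIter_mul {K : Type*} [Field K] {f : K[X]} (hd : f.natDegree ≠ 0)
    {e c₀ : K} {j : ℕ} (he : e ≠ 0) (hder : derivative f = C e * X ^ j * (X - C c₀))
    (h0 : ∀ k, 1 ≤ k → eval 0 (polyIter f k) ≠ 0)
    (hc₀ : ∀ k, 1 ≤ k → eval c₀ (polyIter f k) ≠ 0) {n m : ℕ} (hnm : n < m) :
    ¬ IsSquare (polyIter f n * polyIter f m) := by
  rintro ⟨G, hG⟩
  let L := AlgebraicClosure K
  have hL : ∀ c : K, c ≠ 0 → algebraMap K L c ≠ 0 := fun c hc ↦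
    (_root_.map_ne_zero (algebraMap K L)).mpr hc
  have hk : ∀ c : K, (∀ k, 1 ≤ k → eval c (polyIter f k) ≠ 0) → ∀ k, 1 ≤ k →
      aeval (algebraMap K L c) (polyIter f k) ≠ 0 := fun c hc k hk ↦ by
    rw [aeval_algebraMap_apply_eq_algebraMap_eval]
    exact hL _ (hc k hk)
  obtain ⟨β, hβ⟩ := IsAlgClosed.exists_aeval_eq_zero L (polyIter f n) (by
    rw [degree_eq_natDegree, natDegree_polyIter]
    · exact_mod_cast pow_ne_zero _ hd
    · rintro h
      have := natDegree_polyIter f n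
      rw [h, natDegree_zero] at this
      exact pow_ne_zero _ hd this.symm)
  have hm : aeval β (polyIter f m) ≠ 0 := by
    rw [aeval_polyIter, ← Nat.sub_add_cancel hnm.le, Function.iterate_add_apply, ← aeval_polyIter,
      ← aeval_polyIter, hβ]
    simpa using hk 0 h0 (m - n) (by omega)
  have hmap : ∀ k, eval β (polyIter (f.map (algebraMap K L)) k) = aeval β (polyIter f k) :=
      fun k ↦ by
    rw [← polyIter_map, eval_map_algebraMap]
  have hn' : aeval β (derivative (polyIter f n)) ≠ 0 := by
    have h := eval_derivative_polyIter_ne_zero (f := f.map (algebraMap K L)) (n := n) (β := β)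
      (fun c hc k hk1 ↦ by
        rw [← polyIter_map, eval_map_algebraMap]
        rw [derivative_map, eval_map_algebraMap, hder] at hc
        simp only [map_mul, map_pow, map_sub, aeval_X, aeval_C, mul_eq_zero, sub_eq_zero] at hc
        rcases hc with (hc | hc) | hc
        · exact absurd hc (hL _ he)
        · simpa [eq_zero_of_pow_eq_zero hc] using hk 0 h0 k hk1
        · exact hc ▸ hk c₀ hc₀ k hk1) (by rw [hmap, hβ]) n le_rfl
    rwa [← polyIter_map, derivative_map, eval_map_algebraMap] at h
  have hGβ : aeval β G = 0 := by
    have := congrArg (aeval β) hG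
    rw [map_mul, map_mul, hβ, zero_mul] at this
    exact mul_self_eq_zero.mp this.symm
  have h := congrArg (fun F ↦ aeval β (derivative F)) hG
  simp only [derivative_mul, map_add, map_mul, hβ, hGβ, zero_mul, mul_zero, add_zero] at h
  exact mul_ne_zero hn' hm h

end NonSquare

section Windows

lemma pow_mod_two (d : ℕ) {n : ℕ} (hn : n ≠ 0) : d ^ n % 2 = d % 2 := by
  rw [Nat.pow_mod]
  rcases Nat.mod_two_eq_zero_or_one d with h | h <;> simp [h, hn]

lemma sum_range_two_mul_pow_mod_two (d : ℕ) {n : ℕ} (hn : n ≠ 0) :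
    (∑ l ∈ Finset.range (2 * n), d ^ l) % 2 = (d + 1) % 2 := by
  induction n with
  | zero => exact absurd rfl hn
  | succ n ih =>
    rcases eq_or_ne n 0 with rfl | hn
    · simp [Finset.sum_range_succ, add_comm]
    · have h1 := pow_mod_two d (n := 2 * n) (by omega)
      have h2 := pow_mod_two d (n := 2 * n + 1) (by omega)
      have := ih hn
      rw [show 2 * (n + 1) = 2 * n + 1 + 1 by ring, Finset.sum_range_succ, Finset.sum_range_succ]
      omega

lemma Rat.intCast_div_pow_mem_subringAwayFrom (z b : ℤ) (k : ℕ) :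
    (z : ℚ) / b ^ k ∈ Rat.subringAwayFrom b.natAbs := by
  rw [Rat.mem_subringAwayFrom]
  intro p hp h
  have h1 : (((z : ℚ) / b ^ k).den : ℤ) ∣ b ^ k := by
    have := Rat.den_dvd z (b ^ k)
    rwa [Rat.divInt_eq_div, Int.cast_pow] at this
  have h2 : (p : ℤ) ∣ b := Int.Prime.dvd_pow' hp ((Int.natCast_dvd_natCast.mpr h).trans h1)
  exact Int.natCast_dvd.mp h2

/-- The values at which `f^(n)(a / b)` can be a multiple of a square if its numerator has no odd
valuation away from `Z`. -/
lemma exists_aeval_polyIter_eq_mul_sq (f : ℤ[X]) {a b Z : ℤ} (hb : b ≠ 0) (hZ : Z ≠ 0) {n : ℕ}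
    (hn : n ≠ 0) (h : ¬ HasOddValuationAwayFrom Z (orbitNum f a b n)) :
    ∃ s ∈ (Finset.Icc (-|Z|) |Z|).image (fun s : ℤ ↦ (s : ℚ) / (b : ℚ) ^ (f.natDegree % 2)),
      ∃ c ∈ Rat.subringAwayFrom b.natAbs, aeval ((a : ℚ) / b) (polyIter f n) = s * c ^ 2 := by
  obtain ⟨s, c, hs, hsc⟩ := exists_eq_mul_sq_of_not_hasOddValuationAwayFrom hZ h
  have hb' : (b : ℚ) ≠ 0 := Int.cast_ne_zero.mpr hb
  refine ⟨_, Finset.mem_image_of_mem _ (Finset.mem_Icc.mpr (abs_le.mp hs)), _,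
    Rat.intCast_div_pow_mem_subringAwayFrom c b (f.natDegree ^ n / 2), ?_⟩
  have h1 := intCast_orbitNum f a hb' n
  have h2 : f.natDegree ^ n = f.natDegree ^ n / 2 * 2 + f.natDegree % 2 := by
    have := pow_mod_two f.natDegree hn
    omega
  rw [hsc] at h1
  push_cast at h1
  set N := f.natDegree ^ n / 2
  rw [h2, pow_add, pow_mul] at h1
  field_simp
  linear_combination -h1

lemma exists_window (f : ℤ[X]) (hd : 2 ≤ f.natDegree) {a b Z : ℤ} (hb : b ≠ 0) (hZ : Z ≠ 0)
    {e : ℚ} {j : ℕ} (he : e ≠ 0)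
    (hder : derivative (f.map (Int.castRingHom ℚ)) = C e * X ^ j * (X - C ((a : ℚ) / b)))
    (h0 : ∀ k, 1 ≤ k → eval 0 (polyIter f k) ≠ 0)
    (hinj : Function.Injective fun n ↦ aeval ((a : ℚ) / b) (polyIter f n))
    (hγ : ∀ k, 1 ≤ k → aeval ((a : ℚ) / b) (polyIter f k) ≠ 0) {r : ℕ} (hr : r ≠ 0) :
    ∃ W T : ℕ, ∀ t, T ≤ t → ∃ t', t < t' ∧ t' ≤ t + W ∧
      HasOddValuationAwayFrom Z (orbitNum f a b (2 * r * t')) := by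
  classical
  set S := (Finset.Icc (-|Z|) |Z|).image (fun s : ℤ ↦ (s : ℚ) / (b : ℚ) ^ (f.natDegree % 2))
  set R := Rat.subringAwayFrom b.natAbs
  set V := Rat.placesOver b.natAbs
  set g : ℕ → ℚ[X] := fun i ↦ polyIter (f.map (Int.castRingHom ℚ)) (2 * r * i) with hg
  have hlc : f.leadingCoeff ≠ 0 := leadingCoeff_ne_zero.mpr (ne_zero_of_natDegree_gt hd)
  have hinjQ : Function.Injective (Int.castRingHom ℚ) := Int.cast_injective
  have hdeg : (f.map (Int.castRingHom ℚ)).natDegree = f.natDegree :=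
    natDegree_map_eq_of_injective hinjQ f
  have hb' : b.natAbs ≠ 0 := Int.natAbs_ne_zero.mpr hb
  have heval : ∀ (x : ℚ) n, eval x (polyIter (f.map (Int.castRingHom ℚ)) n) =
      aeval x (polyIter f n) := fun x n ↦ by
    rw [← polyIter_map, eval_map, aeval_def, algebraMap_int_eq]
  set W := S.card * 2 ^ V.card + 1 with hW
  have hpos : ∀ i ∈ Finset.Icc 1 W, 2 * r * i ≠ 0 := fun i hi ↦ by
    have := (Finset.mem_Icc.mp hi).1
    positivity
  obtain ⟨E, hEfin, hE⟩ := exists_finite_forall_exists_eval_ne (V := V) (R := R) (S := S)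
    (I := Finset.Icc 1 W) (g := g) (ε := f.natDegree % 2)
    (l := (f.leadingCoeff : ℚ) ^ ((f.natDegree + 1) % 2))
    (a := fun i ↦ (f.leadingCoeff : ℚ) ^ ((∑ l ∈ Finset.range (2 * r * i), f.natDegree ^ l) / 2))
    (m := fun i ↦ f.natDegree ^ (2 * r * i) / 2)
    (fun x hx hx0 ↦ Rat.one_le_prod_placesOver hb' hx hx0) (Rat.finite_setOf_placesOver_le hb')
    (by
      intro s hs
      obtain ⟨z, -, rfl⟩ := Finset.mem_image.mp hs
      exact Rat.intCast_div_pow_mem_subringAwayFrom z b _)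
    (pow_ne_zero _ (Int.cast_ne_zero.mpr hlc))
    (fun i _ ↦ pow_ne_zero _ (Int.cast_ne_zero.mpr hlc))
    (fun i hi ↦ by
      have := Nat.le_self_pow (hpos i hi) f.natDegree
      have : 2 ≤ f.natDegree ^ (2 * r * i) := by omega
      exact Nat.div_pos this two_pos)
    (fun i hi ↦ by
      have := pow_mod_two f.natDegree (hpos i hi)
      rw [hg, natDegree_polyIter, hdeg]
      omega)
    (fun i hi ↦ by
      rw [hg, leadingCoeff_polyIter _ (by omega), hdeg, leadingCoeff_map_of_injective hinjQ,
        ← pow_mul, ← pow_add]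
      have := sum_range_two_mul_pow_mod_two f.natDegree (n := r * i)
        (by have := hpos i hi; rw [mul_assoc] at this; omega)
      rw [mul_assoc, ← this, mul_comm _ 2, Nat.mod_add_div]
      rfl)
    (fun i hi j hj hij ↦ by
      wlog hlt : i < j generalizing i j
      · rw [mul_comm]
        exact this j hj i hi hij.symm (by omega)
      refine not_isSquare_polyIter_mul (by omega) he hder (fun k hk ↦ ?_) (fun k hk ↦ ?_)
        (Nat.mul_lt_mul_of_pos_left hlt (by positivity))
      · rw [heval]
        have h := aeval_algebraMap_apply_eq_algebraMap_eval (A := ℚ) (0 : ℤ) (polyIter f k)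
        rw [map_zero, eq_intCast] at h
        rw [h]
        exact Int.cast_ne_zero.mpr (h0 k hk)
      · rw [heval]
        exact hγ k hk)
    (by simp [W])
  obtain ⟨T, hT⟩ := (hEfin.preimage hinj.injOn).bddAbove
  refine ⟨W, T + 1, fun t ht ↦ ?_⟩
  set x := aeval ((a : ℚ) / b) (polyIter f (2 * r * t)) with hx
  have hxR : x ∈ R := by
    have h1 := intCast_orbitNum f a (Int.cast_ne_zero.mpr hb : (b : ℚ) ≠ 0) (2 * r * t)
    have h2 : x = (orbitNum f a b (2 * r * t) : ℚ) / (b : ℚ) ^ f.natDegree ^ (2 * r * t) := by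
      have : (b : ℚ) ≠ 0 := Int.cast_ne_zero.mpr hb
      rw [h1, mul_div_cancel_left₀ _ (pow_ne_zero _ this)]
    rw [h2]
    exact Rat.intCast_div_pow_mem_subringAwayFrom _ _ _
  have hxE : x ∉ E := fun hxE ↦ by
    have h1 := hT (show 2 * r * t ∈ _ from hxE)
    have h2 : t ≤ 2 * r * t := Nat.le_mul_of_pos_left _ (by positivity)
    omega
  obtain ⟨i, hi, hgi⟩ := hE x hxR hxE
  refine ⟨t + i, ?_, ?_, ?_⟩
  · have := (Finset.mem_Icc.mp hi).1
    omega
  · have := (Finset.mem_Icc.mp hi).2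
    omega
  · by_contra hcon
    obtain ⟨s, hs, c, hc, hsc⟩ := exists_aeval_polyIter_eq_mul_sq f hb hZ
      (by have := hpos i hi; rw [mul_add]; omega) hcon
    refine hgi s hs c hc ?_
    rw [← hsc, heval, aeval_polyIter, hx, aeval_polyIter, ← Function.iterate_add_apply,
      ← aeval_polyIter, mul_add, add_comm]

end Windows

section Asymptotics

open Filter Real

lemma eventually_log_sq_le_rpow : ∀ᶠ x : ℝ in atTop, log x ^ 2 ≤ x ^ (1 / 4 : ℝ) := by
  have h := (isLittleO_log_rpow_rpow_atTop 2 (show (0 : ℝ) < 1 / 4 by norm_num)).bound one_pos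
  filter_upwards [h, eventually_ge_atTop 1] with x hx hx1
  have hx0 : 0 ≤ x ^ (1 / 4 : ℝ) := rpow_nonneg (by linarith) _
  rw [one_mul, norm_of_nonneg hx0, norm_eq_abs] at hx
  exact_mod_cast (le_abs_self _).trans hx

lemma eventually_pow_double_exp_le {A : ℝ} (hA : 1 < A) :
    ∀ᶠ x : ℝ in atTop, ∀ z ≤ log (log x),
      4 * exp (log A * z) ^ 2 ≤ x ^ (1 / 2 : ℝ) := by
  have hA0 : 0 < log A := log_pos hA
  have h := ((isLittleO_log_id_atTop.comp_tendsto tendsto_log_atTop).bound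
    (show 0 < 1 / (8 * log A) by positivity))
  filter_upwards [h, tendsto_log_atTop.eventually_ge_atTop (4 * log 4), eventually_gt_atTop 1]
    with x hx hx4 hx1 z hzx
  have hlog : 0 < log x := log_pos hx1
  simp only [Function.comp_apply, id, norm_eq_abs, abs_of_pos hlog] at hx
  have h1 := (hzx.trans (le_abs_self _)).trans hx
  rw [div_mul_eq_mul_div, one_mul, le_div_iff₀ (by positivity)] at h1
  rw [← exp_nat_mul, rpow_def_of_pos (by linarith), ← exp_log (show (0 : ℝ) < 4 by norm_num),
    ← exp_add]
  refine exp_le_exp.mpr ?_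
  push_cast
  linarith

lemma le_add_one_mul_of_mul_sq_le {P n u t w k : ℝ} (hn : 0 < n)
    (h : P * n ^ 2 ≤ n * u + n ^ 2 * t) (hu : u ≤ n * (k * w)) (ht : t ≤ w) :
    P ≤ (k + 1) * w := by
  refine le_of_mul_le_mul_right ?_ (pow_pos hn 2)
  calc P * n ^ 2 ≤ n * (n * (k * w)) + n ^ 2 * w := h.trans (by gcongr)
    _ = (k + 1) * w * n ^ 2 := by ring

lemma exists_bound_of_sieve_bound {P : ℕ → ℝ} {A K d q : ℕ} (hA : 2 ≤ A) (hd : 2 ≤ d)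
    (hK : K ≠ 0) (h : ∀ Q N D : ℕ, q ≤ Q → N ≠ 0 → 2 ≤ D → D < Q →
      P Q * N ^ 2 ≤ N * ((Q + 1) * 2 / log (D + 1) + D ^ 4) +
        N ^ 2 * (D ^ 4 * (4 * ((A : ℝ) ^ d ^ (K * N)) ^ 2))) :
    ∃ C : ℝ, 0 < C ∧ ∃ Q₀ : ℕ, ∀ Q : ℕ, Q₀ ≤ Q →
      P Q ≤ C * Q / (log Q * log (log (log Q))) := by
  have hd1 : (1 : ℝ) < d := by exact_mod_cast hd
  have hA1 : (1 : ℝ) < A := by exact_mod_cast hA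
  set c : ℝ := K * log d with hc
  have hc0 : 0 < c := mul_pos (by positivity) (log_pos hd1)
  have hy : Tendsto (fun x : ℝ ↦ log (log (log x))) atTop atTop :=
    tendsto_log_atTop.comp (tendsto_log_atTop.comp tendsto_log_atTop)
  have hll : Tendsto (fun x : ℝ ↦ log (log x)) atTop atTop :=
    tendsto_log_atTop.comp tendsto_log_atTop
  have hev : ∀ᶠ Q : ℕ in atTop, P Q ≤ (130 * c + 1) * Q / (log Q * log (log (log Q))) := by
    have hreal := eventually_log_sq_le_rpow.and <|
      (eventually_pow_double_exp_le hA1).and <|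
      (hy.eventually_ge_atTop (max 1 (2 * c))).and <| (hll.eventually_ge_atTop 1).and <|
      (tendsto_log_atTop.eventually_ge_atTop 1).and <| eventually_ge_atTop (2 ^ 16)
    filter_upwards [tendsto_natCast_atTop_atTop.eventually hreal, eventually_ge_atTop q]
      with Q ⟨h1, h2, h3, h4, h5, h6⟩ hq
    set x : ℝ := (Q : ℝ)
    set y := log (log (log x))
    have hx0 : 0 < x := by linarith
    have hy1 : 1 ≤ y := (le_max_left _ _).trans h3
    have hyc : 2 * c ≤ y := (le_max_right _ _).trans h3
    set N := ⌊y / c⌋₊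
    have hNle : (N : ℝ) ≤ y / c := Nat.floor_le (by positivity)
    have hNge : y / (2 * c) ≤ N := by
      have := Nat.lt_floor_add_one (y / c)
      have h7 : 1 ≤ y / (2 * c) := by rwa [one_le_div (by positivity)]
      have h8 : y / c = 2 * (y / (2 * c)) := by field_simp
      linarith
    have hN0 : (0 : ℝ) < N := lt_of_lt_of_le (by positivity) hNge
    set D := ⌊x ^ (1 / 16 : ℝ)⌋₊
    have hDle : (D : ℝ) ≤ x ^ (1 / 16 : ℝ) := Nat.floor_le (by positivity)
    have hDlt : x ^ (1 / 16 : ℝ) < D + 1 := Nat.lt_floor_add_one _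
    have hD2 : 2 ≤ D := by
      refine Nat.le_floor ?_
      calc ((2 : ℕ) : ℝ) = ((2 : ℝ) ^ (16 : ℝ)) ^ (1 / 16 : ℝ) := by
            rw [← rpow_mul (by norm_num)]; norm_num
        _ ≤ _ := rpow_le_rpow (by positivity) (by exact_mod_cast h6) (by norm_num)
    have hD4 : (D : ℝ) ^ 4 ≤ x ^ (1 / 4 : ℝ) := by
      calc (D : ℝ) ^ 4 ≤ (x ^ (1 / 16 : ℝ)) ^ 4 := by gcongr
        _ = x ^ (1 / 4 : ℝ) := by
          rw [← rpow_natCast, ← rpow_mul hx0.le]; norm_num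
    have hDQ : D < Q := by
      have : (D : ℝ) < x := hDle.trans_lt <| by
        nth_rw 2 [← rpow_one x]
        exact rpow_lt_rpow_of_exponent_lt (by linarith) (by norm_num)
      exact Nat.cast_lt.mp this
    have hlogD : log x / 16 ≤ log (D + 1) := by
      calc log x / 16 = log (x ^ (1 / 16 : ℝ)) := by rw [log_rpow hx0]; ring
        _ ≤ _ := log_le_log (by positivity) hDlt.le
    have hM : 4 * ((A : ℝ) ^ d ^ (K * N)) ^ 2 ≤ x ^ (1 / 2 : ℝ) := by
      have h7 := h2 ((d : ℝ) ^ (K * N)) (by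
        rw [← rpow_natCast, rpow_def_of_pos (by linarith),
          ← exp_log (show 0 < log (log x) by linarith)]
        refine exp_le_exp.mpr ?_
        rw [le_div_iff₀ hc0] at hNle
        push_cast
        calc log d * (K * N) = N * c := by rw [hc]; ring
          _ ≤ _ := hNle)
      have h8 : exp (log A * (d : ℝ) ^ (K * N)) = (A : ℝ) ^ d ^ (K * N) := by
        rw [← rpow_def_of_pos (by linarith), ← Nat.cast_pow, rpow_natCast]
      rwa [h8] at h7
    have hmain := h Q N D hq (by exact_mod_cast hN0.ne') hD2 hDQ
    have hquarter : x ^ (1 / 4 : ℝ) ≤ x / log x := by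
      rw [le_div_iff₀ (by linarith)]
      calc x ^ (1 / 4 : ℝ) * log x ≤ x ^ (1 / 4 : ℝ) * x ^ (3 / 4 : ℝ) := by
            gcongr
            calc log x ≤ log x ^ 2 := le_self_pow₀ h5 two_ne_zero
              _ ≤ x ^ (1 / 4 : ℝ) := h1
              _ ≤ x ^ (3 / 4 : ℝ) := rpow_le_rpow_of_exponent_le (by linarith) (by norm_num)
        _ = x := by rw [← rpow_add hx0]; norm_num
    have hthree : x ^ (1 / 4 : ℝ) * x ^ (1 / 2 : ℝ) ≤ x / (log x * y) := by
      rw [le_div_iff₀ (mul_pos (by linarith) (by linarith))]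
      have hyl : y ≤ log x := (log_le_self (by linarith)).trans (log_le_self (by linarith))
      calc x ^ (1 / 4 : ℝ) * x ^ (1 / 2 : ℝ) * (log x * y)
          ≤ x ^ (1 / 4 : ℝ) * x ^ (1 / 2 : ℝ) * x ^ (1 / 4 : ℝ) := by
            gcongr
            refine le_trans ?_ h1
            rw [sq]
            gcongr
        _ = x := by rw [← rpow_add hx0, ← rpow_add hx0]; norm_num
    have hsieve : (x + 1) * 2 / log (D + 1) ≤ 64 * (x / log x) := by
      rw [div_le_iff₀ (by linarith)]
      calc (x + 1) * 2 ≤ 64 * (x / log x) * (log x / 16) := by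
            field_simp
            linarith
        _ ≤ _ := by gcongr
    have hfirst : (x + 1) * 2 / log (D + 1) + (D : ℝ) ^ 4 ≤ 65 * (x / log x) := by linarith
    have hsecond : (D : ℝ) ^ 4 * (4 * ((A : ℝ) ^ d ^ (K * N)) ^ 2) ≤ x / (log x * y) :=
      (mul_le_mul hD4 hM (by positivity) (by positivity)).trans hthree
    have hNy : 65 * (x / log x) ≤ N * (130 * c * (x / (log x * y))) := by
      calc 65 * (x / log x) = y / (2 * c) * (130 * c * (x / (log x * y))) := by
            field_simp
            norm_num
        _ ≤ _ := by gcongr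
    have hfinal := le_add_one_mul_of_mul_sq_le hN0 hmain (hfirst.trans hNy) hsecond
    rwa [← mul_div_assoc] at hfinal
  obtain ⟨Q₀, hQ₀⟩ := eventually_atTop.mp hev
  exact ⟨130 * c + 1, by positivity, Q₀, hQ₀⟩

end Asymptotics

section Orbits

lemma Function.finite_setOf_iterate_iff {α : Type*} (g : α → α) (x : α) :
    {y | ∃ n, 1 ≤ n ∧ y = g^[n] x}.Finite ↔ ∃ i r, r ≠ 0 ∧ g^[i + r] x = g^[i] x := by
  constructor
  · intro h
    by_contra! hcon
    refine Set.infinite_range_of_injective (f := fun n ↦ g^[n + 1] x) (fun i j hij ↦ ?_)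
      (h.subset (Set.range_subset_iff.mpr fun n ↦ ⟨n + 1, by omega, rfl⟩))
    rcases lt_trichotomy i j with hlt | rfl | hlt
    · refine absurd hij.symm ?_
      have := hcon (i + 1) (j - i) (by omega)
      rwa [show i + 1 + (j - i) = j + 1 by omega] at this
    · rfl
    · refine absurd hij ?_
      have := hcon (j + 1) (i - j) (by omega)
      rwa [show j + 1 + (i - j) = i + 1 by omega] at this
  · rintro ⟨i, r, hr, hir⟩
    refine ((Set.finite_lt_nat (i + r)).image fun n ↦ g^[n] x).subset ?_
    rintro y ⟨n, -, rfl⟩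
    induction n using Nat.strong_induction_on with
    | _ n ih =>
      by_cases hn : n < i + r
      · exact ⟨n, hn, rfl⟩
      · have := ih (n - r) (by omega)
        rwa [show n - r = n - (i + r) + i by omega, Function.iterate_add_apply, ← hir,
          ← Function.iterate_add_apply, Nat.sub_add_cancel (by omega)] at this

lemma isPreperiodicPt_iff (f : ℤ[X]) (x : ℚ) :
    IsPreperiodicPt f x ↔
      ∃ i r, r ≠ 0 ∧ aeval x (polyIter f (i + r)) = aeval x (polyIter f i) := by
  simp only [IsPreperiodicPt, aeval_polyIter]
  exact Function.finite_setOf_iterate_iff _ x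

lemma aeval_zero_eq_intCast {K : Type*} [Field K] (f : ℤ[X]) :
    aeval (0 : K) f = (eval 0 f : ℤ) := by
  simpa using aeval_algebraMap_apply_eq_algebraMap_eval (A := K) (0 : ℤ) f

lemma eval_map_intCast {p : ℕ} (f : ℤ[X]) (x : ZMod p) :
    eval x (f.map (Int.castRingHom (ZMod p))) = aeval x f := by
  rw [eval_map, aeval_def, algebraMap_int_eq]

lemma derivative_map_of_derivative_eq {K : Type*} [Field K] {f : ℤ[X]} {a b : ℤ} {j : ℕ}
    (hder : derivative f = X ^ j * (C b * X - C a)) (hb : (b : K) ≠ 0) :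
    derivative (f.map (Int.castRingHom K)) = C (b : K) * X ^ j * (X - C ((a : K) / b)) := by
  have h : (C (a : K) : K[X]) = C (b : K) * C ((a : K) / b) := by
    rw [← C_mul, mul_div_cancel₀ _ hb]
  rw [derivative_map, hder]
  simp only [Polynomial.map_mul, Polynomial.map_pow, map_X, Polynomial.map_sub, map_C,
    eq_intCast (Int.castRingHom K), h]
  ring

lemma legendreSym_orbitNum_add_two_mul {p : ℕ} [Fact p.Prime] {f : ℤ[X]} (hd : 2 ≤ f.natDegree)
    {a b : ℤ} (hder : derivative f = X ^ (f.natDegree - 2) * (C b * X - C a)) (hp : p ≠ 2)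
    (hb : (b : ZMod p) ≠ 0) (hlc : (f.leadingCoeff : ZMod p) ≠ 0)
    (hirr : DynIrred (f.map (Int.castRingHom (ZMod p)))) {n : ℕ} (hn : 3 ≤ n) (k : ℕ)
    (h0 : eval 0 (polyIter f (n + 2 * k)) = eval 0 (polyIter f n)) :
    legendreSym p (orbitNum f a b (n + 2 * k)) = legendreSym p (orbitNum f a b n) ∧
      legendreSym p (orbitNum f a b n) ^ 2 = 1 := by
  set g := f.map (Int.castRingHom (ZMod p)) with hg
  have hdeg : g.natDegree = f.natDegree := natDegree_map_of_leadingCoeff_ne_zero _ hlc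
  have heval : ∀ (x : ZMod p) n, eval x (polyIter g n) = aeval x (polyIter f n) := fun x n ↦ by
    rw [hg, ← polyIter_map, eval_map_intCast]
  have hne : ∀ n, 1 ≤ n → (orbitNum f a b n : ZMod p) ≠ 0 := fun n hn ↦ by
    rw [intCast_orbitNum f a hb, ← heval]
    exact mul_ne_zero (pow_ne_zero _ hb) (hirr.eval_ne_zero (by omega) hn _)
  have hder' := derivative_map_of_derivative_eq hder hb
  have hpow := hirr.pow_half_eval_polyIter_eq hp (by omega) hb (by rwa [hdeg]) hn k
    (by rw [heval, heval, aeval_zero_eq_intCast, aeval_zero_eq_intCast, h0])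
  have hcast : (legendreSym p (orbitNum f a b (n + 2 * k)) : ZMod p) =
      legendreSym p (orbitNum f a b n) := by
    rw [legendreSym.eq_pow, legendreSym.eq_pow, intCast_orbitNum f a hb, intCast_orbitNum f a hb,
      mul_pow, mul_pow, ← heval, ← heval, hpow, pow_right_comm, pow_right_comm _ (_ ^ n),
      pow_eq_pow_of_mod_two_eq (pow_half_sq hp hb)]
    rw [pow_mod_two _ (by omega), pow_mod_two _ (by omega)]
  have h1 := legendreSym.eq_one_or_neg_one p (hne n (by omega))
  have h2 := legendreSym.eq_one_or_neg_one p (hne (n + 2 * k) (by omega))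
  have : Fact (2 < p) := ⟨by have := (Fact.out : p.Prime).two_le; omega⟩
  refine ⟨?_, by rcases h1 with h | h <;> simp [h]⟩
  rcases h1 with h1 | h1 <;> rcases h2 with h2 | h2 <;> rw [h1, h2] at hcast ⊢ <;>
    push_cast at hcast
  · exact absurd hcast (ZMod.neg_one_ne_one)
  · exact absurd hcast.symm (ZMod.neg_one_ne_one)

end Orbits

section Counting

lemma ZMod.intCast_ne_zero_of_natAbs_lt {p : ℕ} {b : ℤ} (hb : b ≠ 0) (h : b.natAbs < p) :
    (b : ZMod p) ≠ 0 := by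
  rw [Ne, ZMod.intCast_zmod_eq_zero_iff_dvd, Int.natCast_dvd]
  exact fun hdvd ↦ absurd (Nat.le_of_dvd (Int.natAbs_pos.mpr hb) hdvd) (by omega)

lemma Function.iterate_add_mul_of_iterate_add_eq {α : Type*} {g : α → α} {x : α} {i r : ℕ}
    (h : g^[i + r] x = g^[i] x) {n : ℕ} (hn : i ≤ n) (m : ℕ) : g^[n + r * m] x = g^[n] x := by
  have hper : Function.IsPeriodicPt g r (g^[i] x) := by
    rw [Function.IsPeriodicPt, Function.IsFixedPt, ← Function.iterate_add_apply, add_comm, h]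
  obtain ⟨c, rfl⟩ := Nat.exists_eq_add_of_le' hn
  rw [show c + i + r * m = c + (r * m + i) by ring, Function.iterate_add_apply,
    Function.iterate_add_apply, (hper.mul_const m).eq, Function.iterate_add_apply]

open scoped Classical in
lemma Pf_eq_card (f : ℤ[X]) {Q : ℕ} (hQ : Q ≠ 0) :
    Pf f Q = ((Finset.Ioc (Q - 1) (2 * Q)).filter fun p ↦
      p.Prime ∧ DynIrred (f.map (Int.castRingHom (ZMod p)))).card := by
  rw [Pf, ← Set.ncard_coe_finset]
  congr 1
  ext p
  simp only [Set.mem_ofPred_eq, Finset.coe_filter, Finset.mem_Ioc]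
  have : Q - 1 < p ↔ Q ≤ p := by omega
  tauto

lemma Pf_eq_zero_of_eval_eq_zero {f : ℤ[X]} (hd : 2 ≤ f.natDegree) {k : ℕ} (hk : 1 ≤ k)
    (h : eval 0 (polyIter f k) = 0) {Q : ℕ} (hQ : f.leadingCoeff.natAbs < Q) : Pf f Q = 0 := by
  rw [Pf]
  refine (congrArg Set.ncard (Set.eq_empty_of_forall_notMem ?_)).trans (Set.ncard_empty ℕ)
  rintro p ⟨hp, hQp, -, hirr⟩
  have : Fact p.Prime := ⟨hp⟩
  have hlc : (f.leadingCoeff : ZMod p) ≠ 0 :=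
    ZMod.intCast_ne_zero_of_natAbs_lt (leadingCoeff_ne_zero.mpr (by rintro rfl; simp at hd))
      (by omega)
  refine hirr.eval_ne_zero (hd.trans_eq (natDegree_map_of_leadingCoeff_ne_zero _ hlc).symm) hk 0 ?_
  rw [← polyIter_map, eval_map_intCast, aeval_zero_eq_intCast, h, Int.cast_zero]

lemma exists_sieve_bound_Pf {f : ℤ[X]} (hd : 2 ≤ f.natDegree) {a b : ℤ} (hb : b ≠ 0)
    (hder : derivative f = X ^ (f.natDegree - 2) * (C b * X - C a))
    {i₀ r : ℕ} (hr : r ≠ 0) (hper : eval 0 (polyIter f (i₀ + r)) = eval 0 (polyIter f i₀))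
    (h0 : ∀ k, 1 ≤ k → eval 0 (polyIter f k) ≠ 0)
    (hinj : Function.Injective fun n ↦ aeval ((a : ℚ) / b) (polyIter f n))
    (hγ : ∀ k, 1 ≤ k → aeval ((a : ℚ) / b) (polyIter f k) ≠ 0) :
    ∃ A K q : ℕ, 2 ≤ A ∧ K ≠ 0 ∧ ∀ Q N D : ℕ, q ≤ Q → N ≠ 0 → 2 ≤ D → D < Q →
      (Pf f Q : ℝ) * N ^ 2 ≤ N * ((Q + 1) * 2 / Real.log (D + 1) + D ^ 4) +
        N ^ 2 * (D ^ 4 * (4 * ((A : ℝ) ^ f.natDegree ^ (K * N)) ^ 2)) := by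
  classical
  have hbQ : (b : ℚ) ≠ 0 := Int.cast_ne_zero.mpr hb
  have horb : ∀ n, eval 0 (polyIter f n) = (fun t ↦ eval t f)^[n] 0 := fun n ↦ eval_polyIter f 0 n
  have hper' : ∀ n, i₀ ≤ n → ∀ m, eval 0 (polyIter f (n + r * m)) = eval 0 (polyIter f n) :=
    fun n hn m ↦ by
      rw [horb, horb] at hper ⊢
      exact Function.iterate_add_mul_of_iterate_add_eq hper hn m
  obtain ⟨Z, hZ, h2Z, hbZ, hdvd⟩ : ∃ Z : ℤ, Z ≠ 0 ∧ 2 ∣ Z ∧ b ∣ Z ∧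
      ∀ k, 1 ≤ k → eval 0 (polyIter f k) ∣ Z := by
    have hfin : {y | ∃ n, 1 ≤ n ∧ y = eval 0 (polyIter f n)}.Finite := by
      simp only [horb] at hper ⊢
      exact (Function.finite_setOf_iterate_iff _ _).mpr ⟨i₀, r, hr, hper⟩
    refine ⟨2 * b * ∏ v ∈ hfin.toFinset, v, ?_, ⟨b * ∏ v ∈ hfin.toFinset, v, by ring⟩,
      ⟨2 * ∏ v ∈ hfin.toFinset, v, by ring⟩, fun k hk ↦ ?_⟩
    · refine mul_ne_zero (mul_ne_zero two_ne_zero hb) (Finset.prod_ne_zero_iff.mpr fun v hv ↦ ?_)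
      obtain ⟨n, hn, rfl⟩ := hfin.mem_toFinset.mp hv
      exact h0 n hn
    · exact (Finset.dvd_prod_of_mem (fun v ↦ v) (hfin.mem_toFinset.mpr ⟨k, hk, rfl⟩)).mul_left _
  obtain ⟨W, T, hwin⟩ := exists_window f hd hb hZ hbQ (derivative_map_of_derivative_eq hder hbQ)
    h0 hinj hγ hr
  choose! t ht_gt ht_le ht using hwin
  obtain ⟨A, hA2, hA⟩ := exists_abs_orbitNum_le f hd a b
  set S := T + 3 + i₀ with hS
  set s : ℕ → ℕ := fun i ↦ t (S + W * i) with hs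
  have hs_gt : ∀ i, S + W * i < s i := fun i ↦ ht_gt _ (by omega)
  have hs_le : ∀ i, s i ≤ S + W * (i + 1) := fun i ↦ by
    have := ht_le (S + W * i) (by omega)
    simp only [hs]
    linarith
  have hs_mono : StrictMono s := strictMono_nat_of_lt_succ fun i ↦ (hs_le i).trans_lt (hs_gt _)
  have hr1 : 1 ≤ r := Nat.one_le_iff_ne_zero.mpr hr
  have hidx : ∀ i, S ≤ 2 * r * s i := fun i ↦ by nlinarith [hs_gt i, Nat.zero_le (W * i)]
  have hne : ∀ i, orbitNum f a b (2 * r * s i) ≠ 0 := fun i ↦ by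
    rw [← Int.cast_ne_zero (α := ℚ), intCast_orbitNum f a hbQ]
    exact mul_ne_zero (pow_ne_zero _ hbQ) (hγ _ (by have := hidx i; omega))
  have hval : ∀ i j, i < j → ∃ p : ℕ, p.Prime ∧ p ≠ 2 ∧
      Odd (padicValInt p (orbitNum f a b (2 * r * s i) * orbitNum f a b (2 * r * s j))) :=
    fun i j hij ↦ exists_odd_padicValInt_orbitNum_mul f a h2Z hbZ hdvd
      (Nat.mul_lt_mul_of_pos_left (hs_mono hij) (by omega)) (hne i) (hne j) (ht _ (by omega))
  refine ⟨A, 2 * r * (S + W), b.natAbs + f.leadingCoeff.natAbs + 3, hA2,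
    mul_ne_zero (by omega) (by omega), fun Q N D hQ hN hD hDQ ↦ ?_⟩
  have hkey := card_mul_sq_le_of_legendreSym (Finset.range N)
    (fun i ↦ orbitNum f a b (2 * r * s i))
    (M := (A : ℝ) ^ f.natDegree ^ (2 * r * (S + W) * N)) (fun i hi ↦ ?_) (fun i _ ↦ hne i)
    (fun i _ j _ hij ↦ ?_) hD (show Q - 1 ≤ 2 * Q by omega)
    ((Finset.Ioc (Q - 1) (2 * Q)).filter fun p ↦
      p.Prime ∧ DynIrred (f.map (Int.castRingHom (ZMod p)))) (Finset.filter_subset _ _)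
    (fun p hp ↦ ?_) (fun p hp ↦ ?_)
  · rw [← Pf_eq_card f (by omega), Finset.card_range] at hkey
    refine hkey.trans ?_
    have hlog : 0 < Real.log ((D : ℝ) + 1) := Real.log_pos (by norm_cast; omega)
    rw [Nat.cast_sub (by omega), Nat.cast_mul, Nat.cast_ofNat, Nat.cast_one,
      show (2 * (Q : ℝ) - (Q - 1)) = Q + 1 by ring]
    gcongr _ * (?_ + _) + _
    rw [div_le_div_iff₀ (selbergMass_pos (by omega)) hlog, mul_assoc]
    gcongr
    exact log_le_two_mul_selbergMass D
  · have hiN : i + 1 ≤ N := Finset.mem_range.mp hi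
    have hle : 2 * r * s i ≤ 2 * r * (S + W) * N := by
      rw [mul_assoc (2 * r)]
      refine Nat.mul_le_mul_left _ ((hs_le i).trans ?_)
      rw [add_mul]
      exact Nat.add_le_add (Nat.le_mul_of_pos_right _ (by omega)) (Nat.mul_le_mul_left _ hiN)
    have hcast : |((orbitNum f a b (2 * r * s i) : ℤ) : ℝ)| ≤
        (A : ℝ) ^ f.natDegree ^ (2 * r * s i) := by
      exact_mod_cast hA (2 * r * s i)
    refine hcast.trans (pow_le_pow_right₀ (by norm_cast; omega) ?_)
    exact Nat.pow_le_pow_right (by omega) hle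
  · rcases lt_or_gt_of_ne hij with hlt | hlt
    · exact hval i j hlt
    · simpa only [mul_comm] using hval j i hlt
  · obtain ⟨hp, hprime, -⟩ := Finset.mem_filter.mp hp
    exact ⟨hprime, by have := Finset.mem_Ioc.mp hp; omega⟩
  · obtain ⟨hp, hprime, hirr⟩ := Finset.mem_filter.mp hp
    have hQp : Q ≤ p := by have := Finset.mem_Ioc.mp hp; omega
    have : Fact p.Prime := ⟨hprime⟩
    have hleg := fun k ↦ legendreSym_orbitNum_add_two_mul hd hder (by omega)
      (ZMod.intCast_ne_zero_of_natAbs_lt hb (by omega))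
      (ZMod.intCast_ne_zero_of_natAbs_lt
        (leadingCoeff_ne_zero.mpr (by rintro rfl; simp at hd)) (by omega)) hirr
      (n := 2 * r * s 0) (by have := hidx 0; omega) (r * k)
      (by
        have := hper' (2 * r * s 0) (by have := hidx 0; omega) (2 * k)
        rwa [show r * (2 * k) = 2 * (r * k) by ring] at this)
    refine ⟨legendreSym p (orbitNum f a b (2 * r * s 0)), (hleg 0).2, fun i _ _ ↦ ?_⟩
    have hi := (hleg (s i - s 0)).1
    rwa [← mul_assoc 2 r, ← mul_add,
      Nat.add_sub_cancel' (hs_mono.monotone (Nat.zero_le i))] at hi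

end Counting

theorem frequency_P2 (f : ℤ[X]) (d : ℕ) (fd fd1 f0 : ℤ)
    (hd : 2 ≤ d) (hfd : fd ≠ 0) (hfd1 : fd1 ≠ 0)
    (hf : f = C fd * X ^ d + C fd1 * X ^ (d - 1) + C f0)
    (h0 : IsPreperiodicPt f 0)
    (hγ : ¬ IsPreperiodicPt f (-(((d : ℚ) - 1) * (fd1 : ℚ)) / ((d : ℚ) * (fd : ℚ)))) :
    ∃ C : ℝ, 0 < C ∧ ∃ Q₀ : ℕ, ∀ Q : ℕ, Q₀ ≤ Q →
      (Pf f Q : ℝ) ≤ C * Q / (Real.log Q * Real.log (Real.log (Real.log Q))) := by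
  have hdeg : f.natDegree = d := by
    rw [hf]
    compute_degree!
    all_goals omega
  have hder : derivative f =
      X ^ (f.natDegree - 2) * (C ((d : ℤ) * fd) * X - C (-(((d : ℤ) - 1) * fd1))) := by
    obtain ⟨e, rfl⟩ := Nat.exists_eq_add_of_le' hd
    rw [hdeg, hf]
    simp only [Nat.add_sub_cancel, show e + 2 - 1 = e + 1 by omega, derivative_C,
      derivative_C_mul_X_pow, add_zero, Nat.cast_add, Nat.cast_one, Nat.cast_ofNat, map_mul,
      map_neg, map_sub, map_add, map_one, map_natCast, map_ofNat]
    ring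
  have hcast : (-(((d : ℚ) - 1) * (fd1 : ℚ)) / ((d : ℚ) * (fd : ℚ))) =
      ((-(((d : ℤ) - 1) * fd1) : ℤ) : ℚ) / (((d : ℤ) * fd : ℤ) : ℚ) := by
    push_cast
    rfl
  rw [hcast] at hγ
  have hb : (d : ℤ) * fd ≠ 0 := mul_ne_zero (by omega) hfd
  generalize (d : ℤ) * fd = b at *
  generalize -(((d : ℤ) - 1) * fd1) = a at *
  by_cases hz : ∃ k, 1 ≤ k ∧ eval 0 (polyIter f k) = 0
  · obtain ⟨k, hk, hz⟩ := hz
    refine exists_bound_of_sieve_bound (A := 2) (K := 1) (q := f.leadingCoeff.natAbs + 1) le_rfl hd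
      one_ne_zero fun Q N D hQ _ _ _ ↦ ?_
    rw [Pf_eq_zero_of_eval_eq_zero (hdeg ▸ hd) hk hz (by omega), Nat.cast_zero, zero_mul]
    have : 0 ≤ Real.log ((D : ℝ) + 1) := Real.log_nonneg (by simp)
    positivity
  push Not at hz
  obtain ⟨i, r, hr, hir⟩ := (isPreperiodicPt_iff f 0).mp h0
  simp only [isPreperiodicPt_iff, not_exists, not_and] at hγ
  have hinj : Function.Injective fun n ↦ aeval ((a : ℚ) / b) (polyIter f n) := fun m n hmn ↦ by
    by_contra hne
    rcases lt_or_gt_of_ne hne with h | h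
    · refine hγ m (n - m) (by omega) ?_
      rw [Nat.add_sub_cancel' h.le]
      exact hmn.symm
    · refine hγ n (m - n) (by omega) ?_
      rw [Nat.add_sub_cancel' h.le]
      exact hmn
  have hne : ∀ k, 1 ≤ k → aeval ((a : ℚ) / b) (polyIter f k) ≠ 0 := fun k _ hk ↦ by
    refine hγ (i + k) r hr ?_
    rw [aeval_polyIter] at hk
    rw [add_right_comm]
    simpa only [aeval_polyIter, Function.iterate_add_apply _ _ k, hk] using hir
  rw [aeval_zero_eq_intCast, aeval_zero_eq_intCast, Int.cast_inj] at hir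
  obtain ⟨A, K, q, hA, hK, h⟩ := exists_sieve_bound_Pf (hdeg ▸ hd) hb hder hr hir hz hinj hne
  exact exists_bound_of_sieve_bound hA hd hK (hdeg ▸ h)
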